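/- arXiv:2402.10467 — 3 statements merged into one kernel-verified Lean document; each statement's English description precedes it below -/
import Mathlib

section
/- Let q ≥ 8 be a power of 2 such that 3 does not divide q + 1, and let G = SL₂(F_q). Then for every irreducible complex character χ of G of degree q − 1 and every irreducible complex character ψ of G, the inner product ⟨χ³, ψ⟩ is nonzero; that is, c(χ³) = Irr(G). -/
open scoped BigOperators

/-- The standard inner product of complex-valued class functions on a finite group:
`⟨α, β⟩ = |G|⁻¹ ∑ g, α g * conj (β g)`. -/
noncomputable def charInner {G : Type} [Group G] [Finite G] (α β : G → ℂ) : ℂ :=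
  letI : Fintype G := Fintype.ofFinite G
  (Fintype.card G : ℂ)⁻¹ * ∑ g : G, α g * (starRingEnd ℂ) (β g)

/-- `χ : G → ℂ` is an irreducible character if it is the character of some
irreducible (simple) finite-dimensional complex representation of `G`. -/
def IsIrreducibleCharacter (G : Type) [Group G] (χ : G → ℂ) : Prop :=
  ∃ V : FDRep ℂ G, CategoryTheory.Simple V ∧ χ = V.character

section AbelianMultiplicities

variable {A : Type*} [AddCommGroup A] [Fintype A]

/-- The twist of a representation of an abelian group by the inverse of a character. -/
def Representation.addCharTwist {V : Type*} [AddCommGroup V] [Module ℂ V]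
    (ρ : Representation ℂ (Multiplicative A) V) (α : AddChar A ℂ) :
    Representation ℂ (Multiplicative A) V where
  toFun a := α (-a.toAdd) • ρ a
  map_one' := by simp
  map_mul' a b := by
    ext v
    have h : α (-(a * b).toAdd) = α (-a.toAdd) * α (-b.toAdd) := by
      rw [toAdd_mul, neg_add, AddChar.map_add_eq_mul]
    rw [h]
    simp only [map_mul, Module.End.mul_apply, LinearMap.smul_apply, map_smul, mul_smul]
    exact smul_comm _ _ _

theorem Representation.exists_addChar_multiplicity {V : Type*} [AddCommGroup V] [Module ℂ V]
    [FiniteDimensional ℂ V] (ρ : Representation ℂ (Multiplicative A) V) (α : AddChar A ℂ) :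
    ∃ n : ℕ, ∑ a : A, ρ.character (Multiplicative.ofAdd a) * α (-a) = Fintype.card A * n := by
  have hcard : (Nat.card (Multiplicative A) : ℂ) ≠ 0 := by
    simp
  let : Invertible (Nat.card (Multiplicative A) : ℂ) := invertibleOfNonzero hcard
  refine ⟨Module.finrank ℂ (ρ.addCharTwist α).invariants, ?_⟩
  rw [← (ρ.addCharTwist α).card_inv_mul_sum_char_eq_finrank]
  have h : (Nat.card (Multiplicative A) : ℂ) = Fintype.card A := by simp
  rw [h] at hcard ⊢
  rw [mul_inv_cancel_left₀ hcard]
  refine (Fintype.sum_equiv Multiplicative.toAdd _ _ fun a => ?_).symm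
  simp [Representation.character, Representation.addCharTwist, mul_comm]

/-- Fourier inversion on a finite abelian group. -/
theorem AddChar.sum_coeff_mul_apply (f : A → ℂ) (n : AddChar A ℂ → ℕ)
    (hn : ∀ α : AddChar A ℂ, ∑ a, f a * α (-a) = Fintype.card A * n α) (a : A) :
    ∑ α : AddChar A ℂ, (n α : ℂ) * α a = f a := by
  classical
  have hcard : (Fintype.card A : ℂ) ≠ 0 := by simp
  apply mul_left_cancel₀ hcard
  simp_rw [Finset.mul_sum, ← mul_assoc, ← hn, Finset.sum_mul]
  rw [Finset.sum_comm]
  simp_rw [mul_assoc, ← AddChar.map_add_eq_mul, ← Finset.mul_sum, AddChar.sum_apply_eq_ite,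
    neg_add_eq_zero]
  simp [mul_comm]

/-- Parseval's identity on a finite abelian group. -/
theorem AddChar.card_mul_sum_coeff_sq (f : A → ℂ) (n : AddChar A ℂ → ℕ)
    (hn : ∀ α : AddChar A ℂ, ∑ a, f a * α (-a) = Fintype.card A * n α) :
    (Fintype.card A : ℂ) * ∑ α : AddChar A ℂ, (n α : ℂ) ^ 2 = ∑ a, f a * f (-a) := by
  simp_rw [← AddChar.sum_coeff_mul_apply f n hn (-_), Finset.mul_sum]
  rw [Finset.sum_comm]
  refine Finset.sum_congr rfl fun α _ => ?_
  rw [sq, ← mul_assoc, ← hn, Finset.sum_mul]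
  refine Finset.sum_congr rfl fun a _ => by ring

end AbelianMultiplicities

section FiniteGroupCharacters

variable {G : Type} [Group G]

theorem FDRep.exists_addChar_multiplicity {A : Type*} [AddCommGroup A] [Fintype A]
    (V : FDRep ℂ G) (j : Multiplicative A →* G) :
    ∃ n : AddChar A ℂ → ℕ, ∀ α : AddChar A ℂ,
      ∑ a, V.character (j (Multiplicative.ofAdd a)) * α (-a) = Fintype.card A * n α := by
  choose n hn using Representation.exists_addChar_multiplicity (MonoidHom.comp V.ρ j)
  exact ⟨n, fun α => hn α⟩

theorem FDRep.conj_character [Finite G] (V : FDRep ℂ G) (g : G) :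
    (starRingEnd ℂ) (V.character g) = V.character g⁻¹ := by
  let : CommGroup (Subgroup.zpowers g) := IsCyclic.commGroup
  let : Fintype (Additive (Subgroup.zpowers g)) := Fintype.ofFinite _
  let j : Multiplicative (Additive (Subgroup.zpowers g)) →* G :=
    (Subgroup.zpowers g).subtype.comp (MulEquiv.toMultiplicative_toAdditive).toMonoidHom
  obtain ⟨n, hn⟩ := V.exists_addChar_multiplicity j
  have h := AddChar.sum_coeff_mul_apply _ n hn
  have h1 := h (Additive.ofMul ⟨g, Subgroup.mem_zpowers g⟩)
  have h2 := h (-Additive.ofMul ⟨g, Subgroup.mem_zpowers g⟩)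
  have h3 : V.character (j (Multiplicative.ofAdd
      (Additive.ofMul ⟨g, Subgroup.mem_zpowers g⟩))) = V.character g := rfl
  have h4 : V.character (j (Multiplicative.ofAdd
      (-Additive.ofMul ⟨g, Subgroup.mem_zpowers g⟩))) = V.character g⁻¹ := rfl
  rw [h3] at h1
  rw [h4] at h2
  rw [← h1, ← h2]
  simp [AddChar.map_neg_eq_conj]

theorem FDRep.sum_character_mul_inv [Fintype G] (V : FDRep ℂ G) [CategoryTheory.Simple V] :
    ∑ g, V.character g * V.character g⁻¹ = Fintype.card G := by
  have hcard : (Nat.card G : ℂ) ≠ 0 := by simp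
  let : Invertible (Nat.card G : ℂ) := invertibleOfNonzero hcard
  have h := V.char_orthonormal V
  rw [if_pos ⟨CategoryTheory.Iso.refl V⟩] at h
  rw [inv_mul_eq_iff_eq_mul₀ hcard] at h
  simpa using h

/-- An element of a finite abelian subgroup on which the character is constant acts trivially. -/
theorem FDRep.ρ_eq_one_of_character_eq {A : Type*} [AddCommGroup A] [Fintype A]
    (V : FDRep ℂ G) (j : Multiplicative A →* G)
    (h : ∀ a, V.character (j a) = V.character 1) (a : Multiplicative A) : V.ρ (j a) = 1 := by
  let σ : Representation ℂ (Multiplicative A) V := MonoidHom.comp V.ρ j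
  have hcard : (Nat.card (Multiplicative A) : ℂ) ≠ 0 := by simp
  let : Invertible (Nat.card (Multiplicative A) : ℂ) := invertibleOfNonzero hcard
  have h1 := σ.card_inv_mul_sum_char_eq_finrank
  have h2 : ∀ a, σ.character a = Module.finrank ℂ V := fun a => (h a).trans V.char_one
  simp_rw [h2] at h1
  rw [Finset.sum_const, nsmul_eq_mul, Finset.card_univ, ← Nat.card_eq_fintype_card,
    inv_mul_cancel_left₀ hcard] at h1
  have h3 : σ.invariants = ⊤ :=
    Submodule.eq_top_of_finrank_eq (by exact_mod_cast h1.symm)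
  ext v
  exact (h3 ▸ Submodule.mem_top : v ∈ σ.invariants) a

end FiniteGroupCharacters

section Fourier

variable {A : Type*} [AddCommGroup A] [Fintype A] [DecidableEq A]

theorem AddChar.card_mul_coeff_le {k : A → ℝ} {n : AddChar A ℂ → ℕ}
    (hn : ∀ α : AddChar A ℂ, ∑ a, (k a : ℂ) * α (-a) = Fintype.card A * n α)
    (h0 : 0 ≤ k 0) (α : AddChar A ℂ) :
    (Fintype.card A : ℝ) * n α ≤
      k 0 + ((Fintype.card A - 1) + ∑ a with a ≠ 0, k a ^ 2) / 2 := by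
  have h1 : ((Fintype.card A : ℝ) * n α) = ‖∑ a, (k a : ℂ) * α (-a)‖ := by
    rw [hn α, norm_mul, Complex.norm_natCast, Complex.norm_natCast]
  have h2 : ‖∑ a, (k a : ℂ) * α (-a)‖ ≤ ∑ a, |k a| := by
    refine (norm_sum_le _ _).trans (Finset.sum_le_sum fun a _ => ?_)
    rw [norm_mul, AddChar.norm_apply, mul_one, Complex.norm_real, Real.norm_eq_abs]
  have h3 : ∑ a, |k a| = k 0 + ∑ a with a ≠ 0, |k a| := by
    rw [← Finset.add_sum_erase _ _ (Finset.mem_univ 0), abs_of_nonneg h0,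
      Finset.filter_ne']
  have h4 : ∑ a with a ≠ 0, |k a| ≤ ∑ a with a ≠ 0, (1 + k a ^ 2) / 2 := by
    refine Finset.sum_le_sum fun a _ => ?_
    nlinarith [sq_nonneg (|k a| - 1), sq_abs (k a)]
  have h5 : ∑ a : A with a ≠ 0, (1 + k a ^ 2) / 2 =
      ((Fintype.card A - 1) + ∑ a with a ≠ 0, k a ^ 2) / 2 := by
    rw [← Finset.sum_div, Finset.sum_add_distrib, Finset.filter_ne', Finset.sum_const,
      Finset.card_erase_of_mem (Finset.mem_univ 0), Finset.card_univ, nsmul_eq_mul, mul_one,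
      Nat.cast_pred Fintype.card_pos]
  linarith

/-- A function on an abelian group of odd order `N` with nonnegative Fourier coefficients, value
`N - 2` at zero and small norm is the regular character minus `φ + φ⁻¹` for some `φ ≠ 1`. -/
theorem AddChar.exists_eq_neg_add {k : A → ℝ} {n : AddChar A ℂ → ℕ}
    (hn : ∀ α : AddChar A ℂ, ∑ a, (k a : ℂ) * α (-a) = Fintype.card A * n α)
    (hk : ∀ a, k (-a) = k a) (hodd : Odd (Fintype.card A))
    (h0 : k 0 = Fintype.card A - 2)
    (hS : ∑ a with a ≠ 0, k a ^ 2 ≤ 2 * (Fintype.card A - 2)) :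
    ∑ a with a ≠ 0, k a ^ 2 = 2 * (Fintype.card A - 2) ∧ ∃ φ : AddChar A ℂ, φ ≠ 0 ∧
      ∀ a, a ≠ 0 → (k a : ℂ) = -(φ a + φ (-a)) := by
  have hN : (0 : ℝ) < Fintype.card A := by exact_mod_cast Fintype.card_pos
  have hinv := AddChar.sum_coeff_mul_apply (fun a => (k a : ℂ)) n hn
  have hsum : ∑ α, (n α : ℝ) = Fintype.card A - 2 := by
    have h := hinv 0
    simp only [AddChar.map_zero_eq_one, mul_one] at h
    rw [← h0]
    exact_mod_cast h
  have hsq : (Fintype.card A : ℝ) * ∑ α, (n α : ℝ) ^ 2 =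
      (Fintype.card A - 2 : ℝ) ^ 2 + ∑ a with a ≠ 0, k a ^ 2 := by
    have h := AddChar.card_mul_sum_coeff_sq (fun a => (k a : ℂ)) n hn
    simp only [hk] at h
    rw [← h0, Finset.filter_ne', Finset.add_sum_erase _ (fun a => k a ^ 2) (Finset.mem_univ 0)]
    simp only [sq (k _)]
    exact_mod_cast h
  have hle : ∀ α, (0 : ℝ) ≤ (n α : ℝ) ^ 2 - n α := fun α => by
    have : n α ≤ n α ^ 2 := Nat.le_self_pow two_ne_zero _
    rw [sub_nonneg]
    exact_mod_cast this
  have hdiff : ∑ α, ((n α : ℝ) ^ 2 - n α) ≤ 0 := by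
    rw [Finset.sum_sub_distrib, hsum]
    have : (Fintype.card A : ℝ) * (∑ α, (n α : ℝ) ^ 2) ≤
        Fintype.card A * (Fintype.card A - 2) := by rw [hsq]; linarith
    linarith [le_of_mul_le_mul_left this hN]
  have hzero := le_antisymm hdiff (Finset.sum_nonneg fun α _ => hle α)
  have hn01 : ∀ α, n α = 0 ∨ n α = 1 := fun α => by
    have h := (Finset.sum_eq_zero_iff_of_nonneg fun α _ => hle α).1 hzero α (Finset.mem_univ _)
    have h' : (n α : ℝ) * (n α - 1) = 0 := by linear_combination h
    rcases mul_eq_zero.1 h' with h | h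
    · exact Or.inl (by exact_mod_cast h)
    · exact Or.inr (by exact_mod_cast sub_eq_zero.1 h)
  refine ⟨?_, ?_⟩
  · rw [Finset.sum_sub_distrib, hsum, sub_eq_zero] at hzero
    rw [hzero] at hsq
    linarith
  have hind : ∀ α, (1 : ℂ) - n α = if n α = 0 then 1 else 0 := fun α => by
    rcases hn01 α with h | h <;> simp [h]
  have hZ : (Finset.univ.filter fun α => n α = 0).card = 2 := by
    have h : ∑ α : AddChar A ℂ, ((1 : ℂ) - n α) = 2 := by
      rw [Finset.sum_sub_distrib, Finset.sum_const, Finset.card_univ, AddChar.card_eq]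
      have : ∑ α, (n α : ℂ) = Fintype.card A - 2 := by exact_mod_cast congrArg Complex.ofReal hsum
      rw [this, nsmul_eq_mul]
      ring
    simp_rw [hind] at h
    rw [Finset.sum_boole] at h
    exact_mod_cast h
  obtain ⟨φ, β, hne, hφβ⟩ := Finset.card_eq_two.1 hZ
  have hmem : ∀ α, n α = 0 ↔ α = φ ∨ α = β := fun α => by
    simpa using Finset.ext_iff.1 hφβ α
  have hneg : ∀ α, n (-α) = n α := fun α => by
    have h : (Fintype.card A : ℂ) * n (-α) = Fintype.card A * n α := by
      rw [← hn, ← hn]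
      refine Fintype.sum_equiv (Equiv.neg A) _ _ fun a => ?_
      simp [hk, AddChar.neg_apply]
    exact_mod_cast mul_left_cancel₀ (by simp) h
  have hself : ∀ α : AddChar A ℂ, -α = α → α = 0 := fun α h => by
    have h2 : 2 • α = 0 := by rw [two_nsmul, add_eq_zero_iff_eq_neg, h]
    have h3 : addOrderOf α ∣ Fintype.card A := by
      rw [← AddChar.card_eq (α := A)]; exact addOrderOf_dvd_card
    have h4 := Nat.dvd_gcd (addOrderOf_dvd_of_nsmul_eq_zero h2) h3
    rwa [Nat.coprime_iff_gcd_eq_one.1 (Nat.coprime_two_left.2 hodd), Nat.dvd_one,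
      AddMonoid.addOrderOf_eq_one_iff] at h4
  have hβ : β = -φ := by
    rcases (hmem (-φ)).1 (by rw [hneg]; exact (hmem φ).2 (Or.inl rfl)) with h | h
    · have hφ0 := hself φ h
      rcases (hmem (-β)).1 (by rw [hneg]; exact (hmem β).2 (Or.inr rfl)) with h' | h'
      · rw [← h', neg_neg]
      · rw [hself β h', hφ0, neg_zero]
    · exact h.symm
  refine ⟨φ, ?_, fun a ha => ?_⟩
  · rintro rfl
    exact hne (by rw [hβ, neg_zero])
  · have h1 : ∑ α : AddChar A ℂ, ((1 : ℂ) - n α) * α a = φ a + φ (-a) := by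
      simp_rw [hind, ite_mul, one_mul, zero_mul]
      rw [← Finset.sum_filter, hφβ, Finset.sum_pair hne, hβ, AddChar.neg_apply]
    simp_rw [sub_mul, one_mul] at h1
    rw [Finset.sum_sub_distrib, hinv, AddChar.sum_apply_eq_ite, if_neg ha] at h1
    linear_combination -h1

theorem AddChar.sum_cube_mul {k l : A → ℝ} {m : AddChar A ℂ → ℕ} {φ : AddChar A ℂ}
    (hm : ∀ α : AddChar A ℂ, ∑ a, (l a : ℂ) * α (-a) = Fintype.card A * m α)
    (hl : ∀ a, l (-a) = l a) (hk : ∀ a, a ≠ 0 → (k a : ℂ) = -(φ a + φ (-a))) :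
    ∑ a with a ≠ 0, k a ^ 3 * l a =
      8 * l 0 - 2 * Fintype.card A * (m (3 • φ) + 3 * m φ) := by
  have hm' : ∀ α : AddChar A ℂ, ∑ a, (l a : ℂ) * α a = Fintype.card A * m α := fun α => by
    rw [← hm]
    exact Fintype.sum_equiv (Equiv.neg A) _ _ fun a => by simp [hl]
  have h1 : ∑ a with a ≠ 0, (k a : ℂ) ^ 3 * l a = ∑ a with a ≠ 0, -(φ a + φ (-a)) ^ 3 * l a :=
    Finset.sum_congr rfl fun a ha => by
      rw [hk a (by simpa using ha)]
      ring
  have h2 : ∑ a, -(φ a + φ (-a)) ^ 3 * l a =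
      -(8 * l 0) + ∑ a with a ≠ 0, -(φ a + φ (-a)) ^ 3 * l a := by
    rw [← Finset.add_sum_erase _ _ (Finset.mem_univ 0), Finset.filter_ne']
    simp
    norm_num
  have h3 : ∀ a, -(φ a + φ (-a)) ^ 3 * l a = -(l a * (3 • φ) a + l a * (3 • φ) (-a) +
      3 * (l a * φ a) + 3 * (l a * φ (-a))) := fun a => by
    have h : φ a * φ (-a) = 1 := by rw [← AddChar.map_add_eq_mul]; simp
    rw [AddChar.nsmul_apply, AddChar.nsmul_apply]
    linear_combination -(3 * l a * (φ a + φ (-a))) * h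
  simp_rw [h3] at h2
  rw [Finset.sum_neg_distrib] at h2
  simp_rw [Finset.sum_add_distrib, ← Finset.mul_sum, hm, hm'] at h2
  simp_rw [← h3] at h2
  rw [← h1] at h2
  have h4 : ∑ a with a ≠ 0, (k a : ℂ) ^ 3 * l a =
      8 * l 0 - 2 * Fintype.card A * (m (3 • φ) + 3 * m φ) := by
    linear_combination -h2
  exact_mod_cast h4

end Fourier

namespace SL2

open Matrix

variable {F : Type} [Field F]

theorem det_entries (g : Matrix.SpecialLinearGroup (Fin 2) F) :
    g 0 0 * g 1 1 - g 0 1 * g 1 0 = 1 := by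
  rw [← Matrix.det_fin_two]; exact g.2

/-- The element of `SL₂(F)` with the given entries. -/
def ofEntries (a b c d : F) (h : a * d - b * c = 1) : Matrix.SpecialLinearGroup (Fin 2) F :=
  ⟨!![a, b; c, d], by rw [Matrix.det_fin_two_of, h]⟩

section
variable {a b c d : F} {h : a * d - b * c = 1}
@[simp] theorem ofEntries_zero_zero : ofEntries a b c d h 0 0 = a := rfl
@[simp] theorem ofEntries_zero_one : ofEntries a b c d h 0 1 = b := rfl
@[simp] theorem ofEntries_one_zero : ofEntries a b c d h 1 0 = c := rfl
@[simp] theorem ofEntries_one_one : ofEntries a b c d h 1 1 = d := rfl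
end

theorem ext_entries {g h : Matrix.SpecialLinearGroup (Fin 2) F} (h00 : g 0 0 = h 0 0)
    (h01 : g 0 1 = h 0 1) (h10 : g 1 0 = h 1 0) (h11 : g 1 1 = h 1 1) : g = h := by
  ext i j
  fin_cases i <;> fin_cases j <;> assumption

theorem mul_entry (g h : Matrix.SpecialLinearGroup (Fin 2) F) (i j : Fin 2) :
    (g * h) i j = g i 0 * h 0 j + g i 1 * h 1 j := by
  exact (congrFun₂ (Matrix.SpecialLinearGroup.coe_mul g h) i j).trans
    (by rw [Matrix.mul_apply, Fin.sum_univ_two])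

@[simp] theorem one_zero_zero : (1 : Matrix.SpecialLinearGroup (Fin 2) F) 0 0 = 1 := rfl
@[simp] theorem one_zero_one : (1 : Matrix.SpecialLinearGroup (Fin 2) F) 0 1 = 0 := rfl
@[simp] theorem one_one_zero : (1 : Matrix.SpecialLinearGroup (Fin 2) F) 1 0 = 0 := rfl
@[simp] theorem one_one_one : (1 : Matrix.SpecialLinearGroup (Fin 2) F) 1 1 = 1 := rfl

/-- The trace of an element of `SL₂(F)`. -/
def tr (g : Matrix.SpecialLinearGroup (Fin 2) F) : F := g 0 0 + g 1 1

variable [CharP F 2]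

theorem eq_one_of_sq {a : F} (h : a ^ 2 = 1) : a = 1 := by
  have h2 : (2 : F) = 0 := CharTwo.two_eq_zero
  have : (a - 1) ^ 2 = 0 := by linear_combination h + (1 - a) * h2
  exact sub_eq_zero.1 (pow_eq_zero_iff two_ne_zero |>.1 this)

theorem eq_of_sq {a b : F} (h : a ^ 2 = b ^ 2) : a = b := by
  have h2 : (2 : F) = 0 := CharTwo.two_eq_zero
  have : (a - b) ^ 2 = 0 := by linear_combination h + (b ^ 2 - a * b) * h2
  exact sub_eq_zero.1 (pow_eq_zero_iff two_ne_zero |>.1 this)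

/-- The companion matrix of `X² + sX + 1`. -/
def companion (s : F) : Matrix.SpecialLinearGroup (Fin 2) F :=
  ofEntries 0 1 1 s (by linear_combination -(CharTwo.two_eq_zero : (2 : F) = 0))

@[simp] theorem companion_zero_zero (s : F) : companion s 0 0 = 0 := rfl
@[simp] theorem companion_zero_one (s : F) : companion s 0 1 = 1 := rfl
@[simp] theorem companion_one_zero (s : F) : companion s 1 0 = 1 := rfl
@[simp] theorem companion_one_one (s : F) : companion s 1 1 = s := rfl

@[simp] theorem tr_companion (s : F) : tr (companion s) = s := by simp [tr]

@[simp] theorem tr_one : tr (1 : Matrix.SpecialLinearGroup (Fin 2) F) = 0 := by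
  simp [tr, CharTwo.add_self_eq_zero]

theorem exists_cyclic_vector {g : Matrix.SpecialLinearGroup (Fin 2) F} (hg : g ≠ 1) :
    ∃ x y : F, x * (g 1 0 * x + g 1 1 * y) - y * (g 0 0 * x + g 0 1 * y) ≠ 0 := by
  by_contra! H
  have hc : g 1 0 = 0 := by simpa using H 1 0
  have hb : g 0 1 = 0 := by simpa using H 0 1
  have hd : g 1 1 = g 0 0 := by simpa [hb, hc, sub_eq_zero] using H 1 1
  have h1 := det_entries g
  rw [hc, hb, hd] at h1
  have ha : g 0 0 = 1 := eq_one_of_sq (by linear_combination h1)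
  exact hg (ext_entries ha hb hc (hd.trans ha))

variable [Fintype F]

theorem exists_sq_eq (a : F) : ∃ b : F, b ^ 2 = a := by
  obtain ⟨b, hb⟩ := FiniteField.isSquare_of_char_two (ringChar.eq F 2) a
  exact ⟨b, by rw [hb, sq]⟩

theorem exists_conj_companion {g : Matrix.SpecialLinearGroup (Fin 2) F} (hg : g ≠ 1) :
    ∃ h : Matrix.SpecialLinearGroup (Fin 2) F, g = h * companion (tr g) * h⁻¹ := by
  obtain ⟨x, y, hxy⟩ := exists_cyclic_vector hg
  obtain ⟨m, hm⟩ :=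
    exists_sq_eq (x * (g 1 0 * x + g 1 1 * y) - y * (g 0 0 * x + g 0 1 * y))⁻¹
  have hm' : m ^ 2 * (x * (g 1 0 * x + g 1 1 * y) - y * (g 0 0 * x + g 0 1 * y)) = 1 := by
    rw [hm, inv_mul_cancel₀ hxy]
  refine ⟨ofEntries (m * x) (m * (g 0 0 * x + g 0 1 * y)) (m * y) (m * (g 1 0 * x + g 1 1 * y))
    (by linear_combination hm'), ?_⟩
  rw [eq_mul_inv_iff_mul_eq]
  have h2 : (2 : F) = 0 := CharTwo.two_eq_zero
  have hdet := det_entries g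
  apply ext_entries <;> simp [mul_entry, tr]
  · ring
  · linear_combination (-m * x) * hdet - m * x * h2
  · ring
  · linear_combination (-m * y) * hdet - m * y * h2

theorem apply_eq_companion {R : Type*} {f : Matrix.SpecialLinearGroup (Fin 2) F → R}
    (hf : ∀ g h, f (h * g * h⁻¹) = f g) {g : Matrix.SpecialLinearGroup (Fin 2) F} (hg : g ≠ 1) :
    f g = f (companion (tr g)) := by
  obtain ⟨h, hh⟩ := exists_conj_companion hg
  rw [hh, hf, ← hh]

omit [CharP F 2] [Fintype F] in
theorem tr_inv (g : Matrix.SpecialLinearGroup (Fin 2) F) : tr g⁻¹ = tr g := by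
  simp [tr, Matrix.SpecialLinearGroup.SL2_inv_expl, add_comm]

theorem apply_inv {R : Type*} {f : Matrix.SpecialLinearGroup (Fin 2) F → R}
    (hf : ∀ g h, f (h * g * h⁻¹) = f g) (g : Matrix.SpecialLinearGroup (Fin 2) F) :
    f g⁻¹ = f g := by
  by_cases hg : g = 1
  · simp [hg]
  · rw [apply_eq_companion hf hg, apply_eq_companion hf (inv_ne_one.2 hg), tr_inv]

/-- The upper unitriangular matrices. -/
def unipotent : Multiplicative F →* Matrix.SpecialLinearGroup (Fin 2) F where
  toFun x := ofEntries 1 x.toAdd 0 1 (by ring)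
  map_one' := by apply ext_entries <;> simp
  map_mul' x y := by apply ext_entries <;> simp [mul_entry, add_comm]

omit [Fintype F] in
theorem tr_unipotent (x : Multiplicative F) : tr (unipotent x) = 0 := by
  simp [tr, unipotent, CharTwo.add_self_eq_zero]

omit [CharP F 2] [Fintype F] in
theorem unipotent_ne_one {x : F} (hx : x ≠ 0) : unipotent (Multiplicative.ofAdd x) ≠ 1 := by
  intro h
  apply hx
  have : unipotent (Multiplicative.ofAdd x) 0 1 = 0 := by rw [h]; rfl
  exact this

/-- A normal subgroup containing an involution is the whole group. -/
theorem mem_of_normal (N : Subgroup (Matrix.SpecialLinearGroup (Fin 2) F)) [hN : N.Normal]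
    (h0 : unipotent (Multiplicative.ofAdd 1) ∈ N) (g : Matrix.SpecialLinearGroup (Fin 2) F) :
    g ∈ N := by
  have hf : ∀ g h : Matrix.SpecialLinearGroup (Fin 2) F, (h * g * h⁻¹ ∈ N) = (g ∈ N) := fun g h =>
    propext ⟨fun H => by simpa [mul_assoc] using hN.conj_mem _ H h⁻¹, fun H => hN.conj_mem _ H h⟩
  have hinv : ∀ g : Matrix.SpecialLinearGroup (Fin 2) F, tr g = 0 → g ∈ N := by
    intro g hg
    by_cases hg1 : g = 1
    · rw [hg1]; exact N.one_mem
    · have h1 := apply_eq_companion hf hg1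
      have h2 := apply_eq_companion hf (unipotent_ne_one (F := F) one_ne_zero)
      rw [hg] at h1
      rw [tr_unipotent] at h2
      rw [h1, ← h2]
      exact h0
  by_cases hg1 : g = 1
  · rw [hg1]; exact N.one_mem
  · rw [apply_eq_companion hf hg1]
    have h : companion (tr g) = companion 0 * unipotent (Multiplicative.ofAdd (tr g)) := by
      apply ext_entries <;> simp [mul_entry, unipotent]
    rw [h]
    exact N.mul_mem (hinv _ (tr_companion 0)) (hinv _ (tr_unipotent _))

omit [CharP F 2] in
theorem card_special_linear_group :
    Nat.card (Matrix.SpecialLinearGroup (Fin 2) F) =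
      (Fintype.card F - 1) * (Fintype.card F * Fintype.card F) +
        (Fintype.card F - 1) * Fintype.card F := by
  classical
  have h1 : Nat.card {g : Matrix.SpecialLinearGroup (Fin 2) F // g 1 0 = 0} =
      Nat.card (Fˣ × F) := by
    have hne : ∀ g : {g : Matrix.SpecialLinearGroup (Fin 2) F // g 1 0 = 0},
        g.1 0 0 ≠ 0 := fun g h0 => by
      have := det_entries g.1
      rw [g.2, h0] at this
      simp at this
    refine Nat.card_eq_of_bijective (fun g => (Units.mk0 _ (hne g), g.1 0 1)) ⟨?_, ?_⟩
    · intro g h hgh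
      simp only [Prod.mk.injEq, Units.mk0_inj] at hgh
      have hg := det_entries g.1
      have hh := det_entries h.1
      rw [g.2] at hg
      rw [h.2] at hh
      refine Subtype.ext (ext_entries hgh.1 hgh.2 (g.2.trans h.2.symm) ?_)
      apply mul_left_cancel₀ (hne g)
      rw [hgh.1] at hg ⊢
      linear_combination hg - hh
    · rintro ⟨a, b⟩
      exact ⟨⟨ofEntries a b 0 (a⁻¹ : Fˣ) (by simp), by simp⟩, by simp⟩
  have h2 : Nat.card {g : Matrix.SpecialLinearGroup (Fin 2) F // ¬ g 1 0 = 0} =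
      Nat.card (Fˣ × F × F) := by
    refine Nat.card_eq_of_bijective
      (fun g => (Units.mk0 _ g.2, g.1 0 0, g.1 1 1)) ⟨?_, ?_⟩
    · intro g h hgh
      simp only [Prod.mk.injEq, Units.mk0_inj] at hgh
      have hg := det_entries g.1
      have hh := det_entries h.1
      refine Subtype.ext (ext_entries hgh.2.1 ?_ hgh.1 hgh.2.2)
      apply mul_right_cancel₀ g.2
      rw [hgh.1, hgh.2.1, hgh.2.2] at hg
      rw [hgh.1]
      linear_combination hh - hg
    · rintro ⟨c, a, d⟩
      exact ⟨⟨ofEntries a ((a * d - 1) * (c⁻¹ : Fˣ)) c d (by simp), by simp⟩, by simp⟩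
  rw [← Nat.card_congr (Equiv.sumCompl fun g : Matrix.SpecialLinearGroup (Fin 2) F => g 1 0 = 0),
    Nat.card_sum, h1, h2]
  simp [Nat.card_eq_fintype_card, Fintype.card_units]
  ring

theorem card_tr_eq_zero :
    Nat.card {g : Matrix.SpecialLinearGroup (Fin 2) F // tr g = 0} = Fintype.card F ^ 2 := by
  have h2 : (2 : F) = 0 := CharTwo.two_eq_zero
  rw [sq, ← Nat.card_eq_fintype_card, ← Nat.card_prod]
  refine Nat.card_eq_of_bijective (fun g => (g.1 0 1, g.1 1 0)) ⟨?_, ?_⟩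
  · rintro ⟨g, hg⟩ ⟨h, hh⟩ hgh
    simp only [Prod.mk.injEq] at hgh
    simp only [tr] at hg hh
    have h0 : g 0 0 = h 0 0 := by
      apply eq_of_sq
      have e1 := det_entries g
      have e2 := det_entries h
      rw [hgh.1, hgh.2] at e1
      linear_combination g 0 0 * hg - h 0 0 * hh - e1 + e2
    refine Subtype.ext (ext_entries h0 hgh.1 hgh.2 ?_)
    linear_combination hg - hh - h0
  · rintro ⟨b, c⟩
    obtain ⟨a, ha⟩ := exists_sq_eq (1 + b * c)
    exact ⟨⟨ofEntries a b c a (by linear_combination ha), by simp [tr, CharTwo.add_self_eq_zero]⟩,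
      by simp⟩

/-- The polynomial `X² + sX + 1` has no root. -/
def IsNonsplit (s : F) : Prop := ∀ x : F, x ^ 2 + s * x + 1 ≠ 0

omit [Fintype F] in
theorem IsNonsplit.ne_zero {s : F} (hs : IsNonsplit s) : s ≠ 0 := by
  rintro rfl
  apply hs 1
  linear_combination (CharTwo.two_eq_zero : (2 : F) = 0)

theorem card_tr_eq_of_isNonsplit {s : F} (hs : IsNonsplit s) :
    Nat.card {g : Matrix.SpecialLinearGroup (Fin 2) F // tr g = s} =
      Fintype.card F * (Fintype.card F - 1) := by
  classical
  have h2 : (2 : F) = 0 := CharTwo.two_eq_zero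
  have hne : ∀ g : {g : Matrix.SpecialLinearGroup (Fin 2) F // tr g = s}, g.1 0 1 ≠ 0 := by
    rintro ⟨g, hg⟩ h0
    apply hs (g 0 0)
    have := det_entries g
    simp only [tr] at hg
    simp only at h0
    rw [h0] at this
    linear_combination (-g 0 0) * hg + this + (g 0 0 ^ 2 + g 0 0 * g 1 1) * h2 -
      (g 0 0 * g 1 1 - 1) * h2
  have hcard : Fintype.card F * (Fintype.card F - 1) = Nat.card (F × Fˣ) := by
    simp [Nat.card_eq_fintype_card, Fintype.card_units]
  rw [hcard]
  refine Nat.card_eq_of_bijective (fun g => (g.1 0 0, Units.mk0 _ (hne g))) ⟨?_, ?_⟩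
  · intro g h hgh
    simp only [Prod.mk.injEq, Units.mk0_inj] at hgh
    have hg := g.2
    have hh := h.2
    simp only [tr] at hg hh
    have h11 : g.1 1 1 = h.1 1 1 := by linear_combination hg - hh - hgh.1
    refine Subtype.ext (ext_entries hgh.1 hgh.2 ?_ h11)
    apply mul_left_cancel₀ (hne g)
    have e1 := det_entries g.1
    have e2 := det_entries h.1
    rw [hgh.1, h11] at e1
    rw [hgh.2] at e1 ⊢
    linear_combination e2 - e1
  · rintro ⟨a, b⟩
    refine ⟨⟨ofEntries a b ((a * (s - a) - 1) * (b⁻¹ : Fˣ)) (s - a) ?_, by simp [tr]⟩, by simp⟩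
    rw [mul_left_comm]
    simp

/-- The Artin–Schreier map `x ↦ x² + x`. -/
def artinSchreier : F →+ F where
  toFun x := x ^ 2 + x
  map_zero' := by simp
  map_add' x y := by linear_combination x * y * (CharTwo.two_eq_zero : (2 : F) = 0)

theorem index_range_artinSchreier : (artinSchreier (F := F)).range.index = 2 := by
  have h2 : (2 : F) = 0 := CharTwo.two_eq_zero
  rw [AddSubgroup.index_range]
  rw [Nat.card_eq_two_iff]
  refine ⟨0, ⟨1, ?_⟩, ?_, ?_⟩
  · change (1 : F) ^ 2 + 1 = 0
    linear_combination h2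
  · simp [Subtype.ext_iff]
  · ext ⟨x, hx⟩
    change x ^ 2 + x = 0 at hx
    have : x * (x - 1) = 0 := by linear_combination hx - x * h2
    simpa [Subtype.ext_iff, sub_eq_zero] using this

omit [Fintype F] in
theorem IsNonsplit.notMem_range {s : F} (hs : IsNonsplit s) :
    (s ^ 2)⁻¹ ∉ (artinSchreier (F := F)).range := by
  rintro ⟨y, hy⟩
  change y ^ 2 + y = _ at hy
  have hs0 := hs.ne_zero
  apply hs (s * y)
  field_simp at hy
  linear_combination hy + (CharTwo.two_eq_zero : (2 : F) = 0)

theorem exists_isNonsplit : ∃ t : F, IsNonsplit t := by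
  have h2 : (2 : F) = 0 := CharTwo.two_eq_zero
  have h : (artinSchreier (F := F)).range ≠ ⊤ := fun h => by
    have := index_range_artinSchreier (F := F)
    rw [h] at this
    simp at this
  obtain ⟨w, hw⟩ : ∃ w, w ∉ (artinSchreier (F := F)).range := by
    by_contra! H
    exact h ((AddSubgroup.eq_top_iff' _).2 H)
  have hw0 : w ≠ 0 := fun h => hw (h ▸ AddSubgroup.zero_mem _)
  obtain ⟨t, ht⟩ := exists_sq_eq w⁻¹
  have ht0 : t ≠ 0 := by
    rintro rfl
    exact inv_ne_zero hw0 (by simpa using ht.symm)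
  refine ⟨t, fun x hx => hw ⟨x / t, ?_⟩⟩
  change (x / t) ^ 2 + x / t = w
  rw [← inv_inv w, ← ht]
  field_simp
  linear_combination hx - h2

/-- The centralizer of the companion matrix of `X² + tX + 1`. -/
def torus (t : F) : Subgroup (Matrix.SpecialLinearGroup (Fin 2) F) where
  carrier := {g | g 1 0 = g 0 1 ∧ g 1 1 = g 0 0 + t * g 0 1}
  one_mem' := by simp
  mul_mem' := by
    rintro g h ⟨hg1, hg2⟩ ⟨hh1, hh2⟩
    simp only [Set.mem_ofPred_eq, mul_entry, hg1, hg2, hh1, hh2]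
    constructor <;> ring
  inv_mem' := by
    rintro g ⟨hg1, hg2⟩
    rw [Matrix.SpecialLinearGroup.SL2_inv_expl]
    change -g 1 0 = -g 0 1 ∧ g 0 0 = g 1 1 + t * -g 0 1
    rw [hg1, hg2]
    exact ⟨rfl, by ring⟩

instance (t : F) : IsMulCommutative (torus t) :=
  IsMulCommutative.of_setLike_mul_comm fun g hg h hh => by
    obtain ⟨hg1, hg2⟩ := hg
    obtain ⟨hh1, hh2⟩ := hh
    apply ext_entries <;> simp only [mul_entry, hg1, hg2, hh1, hh2] <;> ring

omit [Fintype F] in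
theorem torus_norm {t : F} (c : torus t) :
    c.1 0 0 ^ 2 + t * c.1 0 0 * c.1 0 1 + c.1 0 1 ^ 2 = 1 := by
  obtain ⟨h1, h2⟩ := c.2
  have h := det_entries c.1
  rw [h1, h2] at h
  linear_combination h + c.1 0 1 ^ 2 * (CharTwo.two_eq_zero : (2 : F) = 0)

omit [Fintype F] in
theorem tr_torus {t : F} (c : torus t) : tr c.1 = t * c.1 0 1 := by
  obtain ⟨h1, h2⟩ := c.2
  rw [tr, h2]
  linear_combination c.1 0 0 * (CharTwo.two_eq_zero : (2 : F) = 0)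

omit [CharP F 2] [Fintype F] in
theorem torus_ext {t : F} {c d : torus t} (h0 : c.1 0 0 = d.1 0 0) (h1 : c.1 0 1 = d.1 0 1) :
    c = d := by
  refine Subtype.ext (ext_entries h0 h1 ?_ ?_)
  · rw [c.2.1, d.2.1, h1]
  · rw [c.2.2, d.2.2, h0, h1]

omit [Fintype F] in
theorem torus_entry_ne_zero {t : F} {c : torus t} (hc : c ≠ 1) : c.1 0 1 ≠ 0 := by
  intro h
  have h1 := torus_norm c
  rw [h] at h1
  exact hc (torus_ext (eq_one_of_sq (by linear_combination h1)) h)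

omit [Fintype F] in
theorem exists_torus {t a b : F} (h : a ^ 2 + t * a * b + b ^ 2 = 1) :
    ∃ c : torus t, c.1 0 0 = a ∧ c.1 0 1 = b :=
  ⟨⟨ofEntries a b b (a + t * b)
    (by linear_combination h - b ^ 2 * (CharTwo.two_eq_zero : (2 : F) = 0)),
      by simp [torus]⟩, rfl, rfl⟩

theorem IsNonsplit.card_torus {t : F} (ht : IsNonsplit t) :
    Nat.card (torus t) = Fintype.card F + 1 := by
  classical
  have h : Nat.card {c : torus t // ¬ c = 1} = Nat.card F := by
    refine Nat.card_eq_of_bijective (fun c => c.1.1 0 0 / c.1.1 0 1) ⟨?_, ?_⟩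
    · intro c d hcd
      simp only at hcd
      have hc := torus_entry_ne_zero c.2
      have hd := torus_entry_ne_zero d.2
      have nc := torus_norm c.1
      have nd := torus_norm d.1
      rw [div_eq_iff hc] at hcd
      have hx := ht (d.1.1 0 0 / d.1.1 0 1)
      have h01 : c.1.1 0 1 = d.1.1 0 1 := by
        apply eq_of_sq
        apply mul_right_cancel₀ hx
        rw [hcd] at nc
        have hd' : d.1.1 0 0 = d.1.1 0 0 / d.1.1 0 1 * d.1.1 0 1 := by field_simp
        generalize d.1.1 0 0 / d.1.1 0 1 = x at *
        rw [hd'] at nd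
        linear_combination nc - nd
      refine Subtype.ext (torus_ext ?_ h01)
      rw [hcd, h01]
      field_simp
    · intro x
      obtain ⟨b, hb⟩ := exists_sq_eq (x ^ 2 + t * x + 1)⁻¹
      have hb1 : b ^ 2 * (x ^ 2 + t * x + 1) = 1 := by rw [hb, inv_mul_cancel₀ (ht x)]
      have hb0 : b ≠ 0 := by
        rintro rfl
        simp at hb1
      obtain ⟨c, hc0, hc1⟩ := exists_torus (t := t) (a := x * b) (b := b)
        (by linear_combination hb1)
      refine ⟨⟨c, ?_⟩, ?_⟩
      · rintro rfl
        exact hb0 hc1.symm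
      · simp only [hc0, hc1]
        field_simp
  rw [← Nat.card_congr (Equiv.sumCompl fun c : torus t => c = 1), Nat.card_sum, h]
  simp [add_comm]

omit [Fintype F] in
theorem IsNonsplit.tr_torus {t : F} (ht : IsNonsplit t) {c : torus t} (hc : c ≠ 1) :
    IsNonsplit (tr c.1) := by
  intro x hx
  have hb := torus_entry_ne_zero hc
  have hn := torus_norm c
  rw [SL2.tr_torus] at hx
  apply ht ((x + c.1 0 0) / c.1 0 1)
  field_simp
  linear_combination hx + hn + x * c.1 0 0 * (CharTwo.two_eq_zero : (2 : F) = 0)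

open Classical in
theorem IsNonsplit.card_torus_tr_eq {t s : F} (ht : IsNonsplit t) (hs : IsNonsplit s) :
    (Finset.univ.filter fun c : torus t => tr c.1 = s).card = 2 := by
  have h2 : (2 : F) = 0 := CharTwo.two_eq_zero
  have ht0 := ht.ne_zero
  have hs0 := hs.ne_zero
  obtain ⟨y, hy⟩ : (s ^ 2)⁻¹ + (t ^ 2)⁻¹ ∈ (artinSchreier (F := F)).range := by
    rw [AddSubgroup.add_mem_iff_of_index_two index_range_artinSchreier]
    exact iff_of_false hs.notMem_range ht.notMem_range
  change y ^ 2 + y = _ at hy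
  field_simp at hy
  obtain ⟨c, hc0, hc1⟩ := exists_torus (t := t) (a := s * y) (b := s / t)
    (by field_simp; linear_combination hy + s ^ 2 * h2)
  obtain ⟨d, hd0, hd1⟩ := exists_torus (t := t) (a := s * y + s) (b := s / t)
    (by field_simp; linear_combination hy + s ^ 2 * h2 + t ^ 2 * s ^ 2 * (y + 1) * h2)
  rw [Finset.card_eq_two]
  refine ⟨c, d, ?_, ?_⟩
  · rintro rfl
    rw [hc0] at hd0
    exact hs0 (by linear_combination -hd0)
  · ext e
    simp only [Finset.mem_filter, Finset.mem_univ, true_and, Finset.mem_insert,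
      Finset.mem_singleton]
    constructor
    · intro he
      rw [SL2.tr_torus] at he
      have he1 : e.1 0 1 = s / t := by rw [eq_div_iff ht0, mul_comm, he]
      have ne := torus_norm e
      have nc := torus_norm c
      rw [he1] at ne
      rw [hc1, hc0] at nc
      have h : (e.1 0 0 - s * y) * (e.1 0 0 - (s * y + s)) = 0 := by
        have hst : t * (s / t) = s := by field_simp
        linear_combination ne - nc - (e.1 0 0 - s * y) * hst +
          (s * y * (s * y + s) - e.1 0 0 * (s * y + s)) * h2
      rcases mul_eq_zero.1 h with h | h
      · exact Or.inl (torus_ext (by rw [hc0]; exact sub_eq_zero.1 h) (by rw [he1, hc1]))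
      · exact Or.inr (torus_ext (by rw [hd0]; exact sub_eq_zero.1 h) (by rw [he1, hd1]))
    · rintro (rfl | rfl)
      · rw [SL2.tr_torus, hc1]; field_simp
      · rw [SL2.tr_torus, hd1]; field_simp

open Classical in
theorem IsNonsplit.sum_filter {t : F} (ht : IsNonsplit t)
    {f : Matrix.SpecialLinearGroup (Fin 2) F → ℝ} (hf : ∀ g h, f (h * g * h⁻¹) = f g) :
    ∑ g with IsNonsplit (tr g), f g = (Fintype.card F : ℝ) * (Fintype.card F - 1) / 2 *
      ∑ c : torus t with c ≠ 1, f c := by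
  have hG : ∑ g with IsNonsplit (tr g), f g = ∑ s : F with IsNonsplit s,
      (Fintype.card F : ℝ) * (Fintype.card F - 1) * f (companion s) := by
    rw [← Finset.sum_fiberwise_of_maps_to (t := Finset.univ.filter IsNonsplit) (g := tr)
      (by simp)]
    refine Finset.sum_congr rfl fun s hs => ?_
    have hs' : IsNonsplit s := by simpa using hs
    have hcard := card_tr_eq_of_isNonsplit hs'
    rw [Nat.card_eq_fintype_card, Fintype.card_subtype] at hcard
    have heq : ((Finset.univ.filter fun g : Matrix.SpecialLinearGroup (Fin 2) F =>
        IsNonsplit (tr g)).filter fun g => tr g = s) = Finset.univ.filter fun g => tr g = s := by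
      ext g
      simp only [Finset.mem_filter, Finset.mem_univ, true_and, and_iff_right_iff_imp]
      rintro rfl
      exact hs'
    rw [heq, Finset.sum_congr rfl (g := fun _ => f (companion s)), Finset.sum_const, hcard,
      nsmul_eq_mul, Nat.cast_mul, Nat.cast_pred Fintype.card_pos]
    intro g hg
    have hg' : tr g = s := by simpa using hg
    rw [← hg']
    refine apply_eq_companion hf ?_
    rintro rfl
    exact hs'.ne_zero (by rw [← hg', tr_one])
  have hC : ∑ c : torus t with c ≠ 1, f c =
      ∑ s : F with IsNonsplit s, 2 * f (companion s) := by
    rw [← Finset.sum_fiberwise_of_maps_to (t := Finset.univ.filter IsNonsplit)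
      (g := fun c : torus t => tr c.1)
      (fun c hc => by simpa using ht.tr_torus (by simpa using hc))]
    refine Finset.sum_congr rfl fun s hs => ?_
    have hs' : IsNonsplit s := by simpa using hs
    have hcard := ht.card_torus_tr_eq hs'
    have hne : ∀ c : torus t, tr c.1 = s → c ≠ 1 := by
      rintro _ h rfl
      exact hs'.ne_zero (by rw [← h]; exact tr_one)
    have heq : ((Finset.univ.filter fun c : torus t => c ≠ 1).filter fun c => tr c.1 = s) =
        Finset.univ.filter fun c => tr c.1 = s := by
      ext c
      simp only [Finset.mem_filter, Finset.mem_univ, true_and, and_iff_right_iff_imp]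
      exact hne c
    rw [heq, Finset.sum_congr rfl (g := fun _ => f (companion s)), Finset.sum_const, hcard,
      nsmul_eq_mul, Nat.cast_two]
    intro c hc
    have hc' : tr c.1 = s := by simpa using hc
    rw [← hc']
    refine apply_eq_companion hf fun h => hne c hc' (Subtype.ext h)
  rw [hG, hC, ← Finset.mul_sum, ← Finset.mul_sum]
  ring

open Classical in
theorem sum_tr_eq_zero
    {f : Matrix.SpecialLinearGroup (Fin 2) F → ℝ} (hf : ∀ g h, f (h * g * h⁻¹) = f g) :
    ∑ g with tr g = 0, f g = f 1 + ((Fintype.card F : ℝ) ^ 2 - 1) * f (companion 0) := by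
  have hcard := card_tr_eq_zero (F := F)
  rw [Nat.card_eq_fintype_card, Fintype.card_subtype] at hcard
  have h1 : (1 : Matrix.SpecialLinearGroup (Fin 2) F) ∈ Finset.univ.filter
      fun g : Matrix.SpecialLinearGroup (Fin 2) F => tr g = 0 := by simp
  rw [← Finset.add_sum_erase _ _ h1, Finset.sum_congr rfl (g := fun _ => f (companion 0)),
    Finset.sum_const, Finset.card_erase_of_mem h1, hcard, nsmul_eq_mul,
    Nat.cast_pred (pow_pos Fintype.card_pos 2), Nat.cast_pow]
  intro g hg
  simp only [Finset.mem_erase, Finset.mem_filter, Finset.mem_univ, true_and] at hg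
  rw [← hg.2]
  exact apply_eq_companion hf hg.1

open Classical in
/-- Summation of a class function over `SL₂(F)`, `F` finite of characteristic two. -/
theorem IsNonsplit.sum_eq {t : F} (ht : IsNonsplit t)
    {f : Matrix.SpecialLinearGroup (Fin 2) F → ℝ} (hf : ∀ g h, f (h * g * h⁻¹) = f g) :
    ∑ g, f g = f 1 + ((Fintype.card F : ℝ) ^ 2 - 1) * f (companion 0) +
      ∑ g with ¬ tr g = 0 ∧ ¬ IsNonsplit (tr g), f g +
      (Fintype.card F : ℝ) * (Fintype.card F - 1) / 2 * ∑ c : torus t with c ≠ 1, f c := by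
  rw [← sum_tr_eq_zero hf, ← ht.sum_filter hf,
    ← Finset.sum_filter_add_sum_filter_not Finset.univ fun g => tr g = 0, add_assoc]
  congr 1
  rw [← Finset.sum_filter_add_sum_filter_not (Finset.univ.filter fun g => ¬ tr g = 0)
    fun g => IsNonsplit (tr g), Finset.filter_filter, Finset.filter_filter, add_comm]
  congr 2
  ext g
  simp only [Finset.mem_filter, Finset.mem_univ, true_and, and_iff_right_iff_imp]
  exact fun h => h.ne_zero

end SL2

namespace SL2

open scoped IsMulCommutative

variable {F : Type} [Field F]

/-- The inclusion of the nonsplit torus, from the additive form of the torus. -/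
def torusHom [CharP F 2] (t : F) :
    Multiplicative (Additive (torus t)) →* Matrix.SpecialLinearGroup (Fin 2) F :=
  (torus t).subtype.comp (MulEquiv.toMultiplicative_toAdditive).toMonoidHom

open Classical in
theorem sum_torus [CharP F 2] [Fintype F] (t : F)
    (f : Matrix.SpecialLinearGroup (Fin 2) F → ℝ) :
    ∑ c : torus t with c ≠ 1, f c =
      ∑ a : Additive (torus t) with a ≠ 0, f (torusHom t (Multiplicative.ofAdd a)) :=
  Finset.sum_equiv Additive.ofMul (by simp) fun _ _ => rfl

section Character

variable [CharP F 2] [Fintype F] (V : FDRep ℂ (Matrix.SpecialLinearGroup (Fin 2) F))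

theorem ofReal_re_character (g : Matrix.SpecialLinearGroup (Fin 2) F) :
    ((V.character g).re : ℂ) = V.character g := by
  rw [← Complex.conj_eq_iff_re, FDRep.conj_character]
  exact apply_inv (fun g h => FDRep.char_conj V g h) g

omit [CharP F 2] [Fintype F] in
theorem re_character_conj (g h : Matrix.SpecialLinearGroup (Fin 2) F) :
    (V.character (h * g * h⁻¹)).re = (V.character g).re := by
  rw [FDRep.char_conj]

omit [CharP F 2] in
theorem card_cast [Fintype (Matrix.SpecialLinearGroup (Fin 2) F)] :
    (Fintype.card (Matrix.SpecialLinearGroup (Fin 2) F) : ℝ) =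
      (Fintype.card F : ℝ) ^ 3 - Fintype.card F := by
  rw [← Nat.card_eq_fintype_card, card_special_linear_group]
  push_cast [Nat.cast_pred (R := ℝ) (Fintype.card_pos (α := F))]
  ring

theorem sum_re_character_sq [CategoryTheory.Simple V]
    [Fintype (Matrix.SpecialLinearGroup (Fin 2) F)] :
    ∑ g, (V.character g).re ^ 2 = (Fintype.card F : ℝ) ^ 3 - Fintype.card F := by
  rw [← card_cast]
  have h := V.sum_character_mul_inv
  have hc : ∀ g, V.character g * V.character g⁻¹ = ((V.character g).re ^ 2 : ℝ) := fun g => by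
    rw [← FDRep.conj_character, ← ofReal_re_character V, Complex.conj_ofReal, Complex.ofReal_re]
    push_cast
    ring
  simp_rw [hc] at h
  exact_mod_cast h

/-- The restriction of a character to a Sylow `2`-subgroup is determined by two multiplicities. -/
theorem exists_multiplicity :
    ∃ A L : ℕ, (V.character 1).re = A + (Fintype.card F - 1) * L ∧
      (V.character (companion 0)).re = A - L := by
  classical
  obtain ⟨n, hn⟩ := V.exists_addChar_multiplicity (unipotent (F := F))
  have : Nontrivial (AddChar F ℂ) := by
    rw [← Fintype.one_lt_card_iff_nontrivial, AddChar.card_eq]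
    exact Fintype.one_lt_card
  obtain ⟨α, hα⟩ := exists_ne (0 : AddChar F ℂ)
  have hsum : ∀ β : AddChar F ℂ, (V.character 1).re - (V.character (companion 0)).re +
      (V.character (companion 0)).re * (if β = 0 then (Fintype.card F : ℂ) else 0) =
      Fintype.card F * n β := fun β => by
    have h1 : ∑ x : F, β (-x) = if β = 0 then (Fintype.card F : ℂ) else 0 := by
      rw [← AddChar.sum_eq_ite β]
      exact Fintype.sum_equiv (Equiv.neg F) _ _ fun _ => rfl
    rw [← hn, ← h1, ofReal_re_character, ofReal_re_character, Finset.mul_sum,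
      ← Finset.add_sum_erase _ _ (Finset.mem_univ 0),
      ← Finset.add_sum_erase Finset.univ (fun x => V.character (unipotent _) * _)
        (Finset.mem_univ 0)]
    rw [Finset.sum_congr rfl (g := fun x =>
      V.character (unipotent (Multiplicative.ofAdd x)) * β (-x))]
    · simp
      ring
    · intro x hx
      rw [apply_eq_companion (fun g h => FDRep.char_conj V g h)
        (unipotent_ne_one (Finset.ne_of_mem_erase hx)), tr_unipotent]
  have h0 := hsum 0
  have h1 := hsum α
  rw [if_pos rfl] at h0
  rw [if_neg hα, mul_zero, add_zero] at h1
  have hq : (Fintype.card F : ℝ) ≠ 0 := by simp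
  have h0' : (V.character 1).re - (V.character (companion 0)).re +
    (V.character (companion 0)).re * (Fintype.card F : ℝ) = Fintype.card F * n 0 := by
      exact_mod_cast h0
  have h1' : (V.character 1).re - (V.character (companion 0)).re =
    (Fintype.card F : ℝ) * n α := by exact_mod_cast h1
  have h2 : (V.character (companion 0)).re = n 0 - n α := by
    apply mul_left_cancel₀ hq
    linear_combination h0' - h1'
  exact ⟨n 0, n α, by linear_combination h1' + h2, h2⟩

open Classical in
theorem exists_torus_multiplicity (t : F) :
    ∃ m : AddChar (Additive (torus t)) ℂ → ℕ, ∀ α : AddChar (Additive (torus t)) ℂ,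
      ∑ a, ((V.character (torusHom t (Multiplicative.ofAdd a))).re : ℂ) * α (-a) =
        Fintype.card (Additive (torus t)) * m α := by
  simp_rw [ofReal_re_character]
  exact V.exists_addChar_multiplicity (torusHom t)

theorem re_character_torus_neg (t : F) (a : Additive (torus t)) :
    (V.character (torusHom t (Multiplicative.ofAdd (-a)))).re =
      (V.character (torusHom t (Multiplicative.ofAdd a))).re := by
  rw [ofAdd_neg, map_inv]
  exact apply_inv (f := fun g => (V.character g).re) (re_character_conj V) _

/-- An irreducible representation with trivial restriction to a Sylow `2`-subgroup is trivial. -/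
theorem character_eq_one [CategoryTheory.Simple V]
    (h : (V.character (companion 0)).re = (V.character 1).re)
    (g : Matrix.SpecialLinearGroup (Fin 2) F) : V.character g = 1 := by
  classical
  have h' : V.character (companion 0) = V.character 1 := by
    rw [← ofReal_re_character, h, ofReal_re_character]
  have hu : V.ρ (unipotent (Multiplicative.ofAdd (1 : F))) = 1 := by
    refine V.ρ_eq_one_of_character_eq unipotent (fun a => ?_) _
    by_cases ha : unipotent a = 1
    · rw [ha]
    · rw [apply_eq_companion (fun g h => FDRep.char_conj V g h) ha, tr_unipotent, h']
  have hconst : ∀ g, V.character g = V.character 1 := fun g => by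
    have : V.ρ g = V.ρ 1 := by
      rw [map_one]
      exact mem_of_normal (MonoidHom.ker V.ρ) hu g
    rw [FDRep.character, FDRep.character, this]
  have hsum := V.sum_character_mul_inv
  simp_rw [hconst] at hsum
  rw [Finset.sum_const, Finset.card_univ, nsmul_eq_mul, mul_eq_left₀ (by simp), FDRep.char_one]
    at hsum
  rw [hconst, FDRep.char_one]
  have : Module.finrank ℂ V * Module.finrank ℂ V = 1 := by exact_mod_cast hsum
  rw [Nat.eq_one_of_mul_eq_one_left this, Nat.cast_one]

open Classical in
theorem IsNonsplit.sum_re_character_sq {t : F} (ht : IsNonsplit t) [CategoryTheory.Simple V] :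
    (V.character 1).re ^ 2 + ((Fintype.card F : ℝ) ^ 2 - 1) * (V.character (companion 0)).re ^ 2 +
      ∑ g with ¬ tr g = 0 ∧ ¬ IsNonsplit (tr g), (V.character g).re ^ 2 +
      (Fintype.card F : ℝ) * (Fintype.card F - 1) / 2 * ∑ a : Additive (torus t) with a ≠ 0,
        (V.character (torusHom t (Multiplicative.ofAdd a))).re ^ 2 =
      (Fintype.card F : ℝ) ^ 3 - Fintype.card F := by
  rw [← SL2.sum_re_character_sq V, ht.sum_eq (f := fun g => (V.character g).re ^ 2)
    (fun g h => by simp only [re_character_conj]),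
    sum_torus t fun g => (V.character g).re ^ 2]

open Classical in
theorem IsNonsplit.card_additive_torus {t : F} (ht : IsNonsplit t) :
    Fintype.card (Additive (torus t)) = Fintype.card F + 1 := by
  rw [← ht.card_torus, ← Nat.card_eq_fintype_card]
  rfl

/-- An irreducible character of degree `q - 1` takes the value `-1` on involutions. -/
theorem re_character_companion_zero [CategoryTheory.Simple V] (hq : 8 ≤ Fintype.card F)
    (hdeg : (V.character 1).re = Fintype.card F - 1) :
    (V.character (companion 0)).re = -1 := by
  have hq' : (8 : ℝ) ≤ Fintype.card F := by exact_mod_cast hq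
  obtain ⟨A, L, h1, h2⟩ := exists_multiplicity V
  rcases L with _ | L
  · have h3 := character_eq_one V (by rw [h1, h2]; simp) 1
    rw [h3, Complex.one_re] at hdeg
    linarith
  · have hA : (0 : ℝ) ≤ A := A.cast_nonneg
    have hL : (0 : ℝ) ≤ L := L.cast_nonneg
    rw [h1] at hdeg
    push_cast at hdeg h2
    have hL0 : 0 ≤ ((Fintype.card F : ℝ) - 1) * L := mul_nonneg (by linarith) hL
    have hL1 : (L : ℝ) = 0 := by nlinarith
    rw [h2, hL1]
    rw [hL1] at hdeg
    linarith

open Classical in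
/-- The restriction to the nonsplit torus, and vanishing on the split torus, of an irreducible
character of degree `q - 1`. -/
theorem IsNonsplit.exists_addChar {t : F} (ht : IsNonsplit t) [CategoryTheory.Simple V]
    (hq : 8 ≤ Fintype.card F) (hdeg : (V.character 1).re = Fintype.card F - 1) :
    (∀ g, tr g ≠ 0 → ¬ IsNonsplit (tr g) → (V.character g).re = 0) ∧
      ∃ φ : AddChar (Additive (torus t)) ℂ, φ ≠ 0 ∧ ∀ a, a ≠ 0 →
        ((V.character (torusHom t (Multiplicative.ofAdd a))).re : ℂ) = -(φ a + φ (-a)) := by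
  have hq' : (8 : ℝ) ≤ Fintype.card F := by exact_mod_cast hq
  have hN := ht.card_additive_torus
  have hN' : (Fintype.card (Additive (torus t)) : ℝ) = Fintype.card F + 1 := by exact_mod_cast hN
  have hnorm := ht.sum_re_character_sq V
  rw [hdeg, re_character_companion_zero V hq hdeg] at hnorm
  have hpos : ∀ g ∈ Finset.univ.filter fun g : Matrix.SpecialLinearGroup (Fin 2) F =>
      ¬ tr g = 0 ∧ ¬ IsNonsplit (tr g), 0 ≤ (V.character g).re ^ 2 := fun g _ => sq_nonneg _
  have hsplit := Finset.sum_nonneg hpos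
  have hc : 0 < (Fintype.card F : ℝ) * (Fintype.card F - 1) / 2 := by
    have : 0 < (Fintype.card F : ℝ) - 1 := by linarith
    positivity
  have hodd : Odd (Fintype.card (Additive (torus t))) := by
    rw [hN]
    exact (Nat.even_iff.2 (FiniteField.even_card_of_char_two (ringChar.eq F 2))).add_one
  obtain ⟨m, hm⟩ := exists_torus_multiplicity V t
  obtain ⟨hS, φ, hφ, hk⟩ := AddChar.exists_eq_neg_add
    (k := fun a => (V.character (torusHom t (Multiplicative.ofAdd a))).re) hm
    (re_character_torus_neg V t) hodd
    (by rw [hN', ofAdd_zero, map_one, hdeg]; ring)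
    (by
      rw [hN']
      apply le_of_mul_le_mul_left _ hc
      linear_combination hnorm + hsplit)
  refine ⟨fun g hg hg' => ?_, φ, hφ, hk⟩
  rw [hS, hN'] at hnorm
  have hzero := (Finset.sum_eq_zero_iff_of_nonneg hpos).1 (by linear_combination hnorm) g
    (by simp [hg, hg'])
  exact pow_eq_zero_iff two_ne_zero |>.1 hzero

open Classical in
theorem IsNonsplit.card_mul_coeff_le {t : F} (ht : IsNonsplit t) [CategoryTheory.Simple V]
    (hq : 8 ≤ Fintype.card F) {m : AddChar (Additive (torus t)) ℂ → ℕ}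
    (hm : ∀ α : AddChar (Additive (torus t)) ℂ,
      ∑ a, ((V.character (torusHom t (Multiplicative.ofAdd a))).re : ℂ) * α (-a) =
        Fintype.card (Additive (torus t)) * m α) (α : AddChar (Additive (torus t)) ℂ) :
    ((Fintype.card F : ℝ) + 1) * m α ≤
      (V.character 1).re + 3 * Fintype.card F / 2 + 1 := by
  have hq' : (8 : ℝ) ≤ Fintype.card F := by exact_mod_cast hq
  have hN' : (Fintype.card (Additive (torus t)) : ℝ) = Fintype.card F + 1 := by
    exact_mod_cast ht.card_additive_torus
  have hc : 0 < (Fintype.card F : ℝ) * (Fintype.card F - 1) / 2 := by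
    have : 0 < (Fintype.card F : ℝ) - 1 := by linarith
    positivity
  have hS : ∑ a : Additive (torus t) with a ≠ 0,
      (V.character (torusHom t (Multiplicative.ofAdd a))).re ^ 2 ≤ 2 * (Fintype.card F + 1) := by
    have hnorm := ht.sum_re_character_sq V
    have hsplit : 0 ≤ ∑ g : Matrix.SpecialLinearGroup (Fin 2) F
        with ¬ tr g = 0 ∧ ¬ IsNonsplit (tr g), (V.character g).re ^ 2 :=
      Finset.sum_nonneg fun g _ => sq_nonneg _
    have hp : 0 ≤ ((Fintype.card F : ℝ) ^ 2 - 1) * (V.character (companion 0)).re ^ 2 :=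
      mul_nonneg (by nlinarith) (sq_nonneg _)
    apply le_of_mul_le_mul_left _ hc
    linear_combination hnorm + hsplit + hp + sq_nonneg (V.character 1).re
  have h1 : (V.character (torusHom t (Multiplicative.ofAdd 0))).re = (V.character 1).re := by
    rw [ofAdd_zero, map_one]
  have h := AddChar.card_mul_coeff_le hm
    (by rw [h1, FDRep.char_one, Complex.natCast_re]; positivity) α
  rw [hN', h1] at h
  linarith

open Classical in
theorem sum_re_character_cube_mul_pos (W : FDRep ℂ (Matrix.SpecialLinearGroup (Fin 2) F))
    [CategoryTheory.Simple V] [CategoryTheory.Simple W] (hq : 8 ≤ Fintype.card F)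
    (h3 : ¬ 3 ∣ Fintype.card F + 1) (hdeg : (V.character 1).re = Fintype.card F - 1) :
    0 < ∑ g, (V.character g).re ^ 3 * (W.character g).re := by
  obtain ⟨t, ht⟩ := exists_isNonsplit (F := F)
  have heven : Even (Fintype.card F) :=
    Nat.even_iff.2 (FiniteField.even_card_of_char_two (ringChar.eq F 2))
  have hq10 : 10 ≤ Fintype.card F := by
    obtain ⟨r, hr⟩ := heven
    omega
  have hq10' : (10 : ℝ) ≤ Fintype.card F := by exact_mod_cast hq10
  have hN' : (Fintype.card (Additive (torus t)) : ℝ) = Fintype.card F + 1 := by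
    exact_mod_cast ht.card_additive_torus
  obtain ⟨hsplit, φ, hφ, hk⟩ := ht.exists_addChar V hq hdeg
  obtain ⟨m, hm⟩ := exists_torus_multiplicity W t
  obtain ⟨A, L, hd, hp⟩ := exists_multiplicity W
  have hcube := AddChar.sum_cube_mul
    (l := fun a => (W.character (torusHom t (Multiplicative.ofAdd a))).re) hm
    (re_character_torus_neg W t) hk
  have hzero : ∑ g : Matrix.SpecialLinearGroup (Fin 2) F with ¬ tr g = 0 ∧ ¬ IsNonsplit (tr g),
      (V.character g).re ^ 3 * (W.character g).re = 0 :=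
    Finset.sum_eq_zero fun g hg => by
      obtain ⟨hg1, hg2⟩ := (Finset.mem_filter.1 hg).2
      rw [hsplit g hg1 hg2]
      ring
  have h : ∑ g, (V.character g).re ^ 3 * (W.character g).re =
      (Fintype.card F : ℝ) * (Fintype.card F - 1) * ((Fintype.card F + 1) *
        (A + Fintype.card F * L) - (Fintype.card F + 1) * (m (3 • φ) + 3 * m φ)) := by
    rw [ht.sum_eq (f := fun g => (V.character g).re ^ 3 * (W.character g).re)
      (fun g h => by simp only [re_character_conj]),
      sum_torus t fun g => (V.character g).re ^ 3 * (W.character g).re, hcube, hzero, hdeg,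
      re_character_companion_zero V hq hdeg, hN', ofAdd_zero, map_one, hd, hp]
    ring
  rw [h]
  have hc : 0 < (Fintype.card F : ℝ) - 1 := by linarith
  refine mul_pos (mul_pos (by linarith) hc) ?_
  rcases L.eq_zero_or_pos with rfl | hL
  · have hW : ∀ g, W.character g = 1 := character_eq_one W (by rw [hd, hp]; simp)
    have hA : (A : ℝ) = 1 := by simpa [hW] using hd.symm
    have hm0 : ∀ α : AddChar (Additive (torus t)) ℂ, α ≠ 0 → (m α : ℝ) = 0 := fun α hα => by
      have h0 := hm α
      simp only [hW, Complex.one_re, Complex.ofReal_one, one_mul] at h0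
      rw [Fintype.sum_equiv (Equiv.neg _) (fun a => α (-a)) α fun _ => rfl,
        AddChar.sum_eq_zero_iff_ne_zero.2 hα, eq_comm, mul_eq_zero] at h0
      simpa using h0
    have h3φ : 3 • φ ≠ 0 := fun h0 => hφ <| by
      have h1 : addOrderOf φ ∣ Fintype.card F + 1 := by
        rw [← ht.card_additive_torus, ← AddChar.card_eq (α := Additive (torus t))]
        exact addOrderOf_dvd_card
      rcases (Nat.dvd_prime Nat.prime_three).1 (addOrderOf_dvd_of_nsmul_eq_zero h0) with h2 | h2
      · exact AddMonoid.addOrderOf_eq_one_iff.1 h2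
      · exact absurd (h2 ▸ h1) h3
    rw [hm0 _ hφ, hm0 _ h3φ, hA]
    simp
    linarith
  · have hL' : (1 : ℝ) ≤ L := by exact_mod_cast hL
    have h1 := ht.card_mul_coeff_le W hq hm φ
    have h2 := ht.card_mul_coeff_le W hq hm (3 • φ)
    rw [hd] at h1 h2
    have hA : (0 : ℝ) ≤ A := A.cast_nonneg
    nlinarith [mul_nonneg hA hc.le, mul_nonneg (sub_nonneg.2 hL') (sub_nonneg.2 hq10'),
      mul_nonneg (mul_nonneg (sub_nonneg.2 hL') (sub_nonneg.2 hq10')) (sub_nonneg.2 hq10'),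
      mul_nonneg (sub_nonneg.2 hq10') (sub_nonneg.2 hq10')]

end Character

end SL2

/-- For `q ≥ 8` a power of `2` with `3 ∤ q + 1` and `G = SL₂(F_q)`, the cube of any
irreducible character of degree `q - 1` contains every irreducible character of `G`. -/
theorem sl2_even_degree_q_minus_one_cube_covers
    (q : ℕ) (hq8 : 8 ≤ q) (hq : ∃ n : ℕ, 1 ≤ n ∧ q = 2 ^ n) (h3 : ¬ (3 ∣ q + 1))
    (F : Type) [Field F] [Fintype F] (hF : Fintype.card F = q)
    (χ ψ : Matrix.SpecialLinearGroup (Fin 2) F → ℂ)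
    (hχ : IsIrreducibleCharacter _ χ) (hχdeg : χ 1 = (q : ℂ) - 1)
    (hψ : IsIrreducibleCharacter _ ψ) :
    charInner (fun g => χ g ^ 3) ψ ≠ 0 := by
  obtain ⟨n, -, hn⟩ := hq
  obtain ⟨V, hV, rfl⟩ := hχ
  obtain ⟨W, hW, rfl⟩ := hψ
  subst hF
  have : CharP F 2 := charP_of_card_eq_prime_pow hn
  have hpos := SL2.sum_re_character_cube_mul_pos V W hq8 h3 (by simp [hχdeg])
  have hsum : ∀ g, V.character g ^ 3 * (starRingEnd ℂ) (W.character g) =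
      ((V.character g).re ^ 3 * (W.character g).re : ℝ) := fun g => by
    rw [← SL2.ofReal_re_character V, ← SL2.ofReal_re_character W, Complex.conj_ofReal]
    simp
  unfold charInner
  simp only [hsum]
  rw [← Complex.ofReal_sum]
  refine mul_ne_zero (by simp) (Complex.ofReal_ne_zero.2 ?_)
  convert hpos.ne'
end

section
/- Let q ≥ 8 be a power of 2 and G = SL₂(F_q). Then for every irreducible complex character χ of G of degree q − 1 and every irreducible complex character ψ of G, the inner product ⟨χ⁴, ψ⟩ is nonzero; that is, c(χ⁴) = Irr(G). -/
open scoped BigOperators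

namespace Representation

section Twist

variable {H V : Type*} [Monoid H] [AddCommGroup V] [Module ℂ V]

/-- The twist of a representation by a linear character. -/
noncomputable def twist (l : H →* ℂ) (ρ : Representation ℂ H V) : Representation ℂ H V where
  toFun h := l h • ρ h
  map_one' := by simp
  map_mul' a b := by simp [smul_smul, mul_comm]

theorem character_twist (l : H →* ℂ) (ρ : Representation ℂ H V) (h : H) :
    (twist l ρ).character h = l h * ρ.character h := by
  simp [character, twist]

end Twist

section CommGroup

variable {H V : Type*} [CommGroup H] [AddCommGroup V] [Module ℂ V] [FiniteDimensional ℂ V]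

/-- The multiplicity of a linear character in a representation of a commutative group. -/
noncomputable def multiplicity (ρ : Representation ℂ H V) (l : AddChar (Additive H) ℂ) : ℕ :=
  Module.finrank ℂ (twist
    { toFun := fun h => l (.ofMul h⁻¹)
      map_one' := by simp
      map_mul' := fun a b => by rw [mul_inv, ofMul_mul, AddChar.map_add_eq_mul] } ρ).invariants

variable [Finite H] (ρ : Representation ℂ H V)

theorem character_eq_sum_multiplicity (h : H) :
    ρ.character h = ∑ l : AddChar (Additive H) ℂ, (ρ.multiplicity l : ℂ) * l (.ofMul h) := by
  classical
  have := Fintype.ofFinite H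
  have hn : (Nat.card H : ℂ) ≠ 0 := by simp [Nat.card_eq_fintype_card]
  have : Invertible (Nat.card H : ℂ) := invertibleOfNonzero hn
  have hm (l : AddChar (Additive H) ℂ) : (ρ.multiplicity l : ℂ) =
      (Nat.card H : ℂ)⁻¹ * ∑ x : H, l (.ofMul x⁻¹) * ρ.character x := by
    rw [multiplicity, ← card_inv_mul_sum_char_eq_finrank]
    simp only [character_twist]
    rfl
  have hs (x : H) : ∑ l : AddChar (Additive H) ℂ, l (.ofMul x⁻¹) * l (.ofMul h) =
      if x = h then (Nat.card H : ℂ) else 0 := by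
    simp_rw [← AddChar.map_add_eq_mul, ← ofMul_mul]
    rw [AddChar.sum_apply_eq_ite]
    simp [Nat.card_eq_fintype_card, neg_add_eq_zero]
  simp_rw [hm, mul_assoc, Finset.sum_mul, ← Finset.mul_sum]
  rw [Finset.sum_comm]
  simp_rw [mul_right_comm _ (ρ.character _), ← Finset.sum_mul, hs]
  simp

theorem sum_multiplicity : ∑ l, ρ.multiplicity l = Module.finrank ℂ V := by
  have := ρ.character_eq_sum_multiplicity 1
  simp only [char_one, ofMul_one, AddChar.map_zero_eq_one, mul_one] at this
  exact_mod_cast this.symm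

theorem norm_character_le_finrank_of_comm (h : H) : ‖ρ.character h‖ ≤ Module.finrank ℂ V := by
  rw [character_eq_sum_multiplicity, ← sum_multiplicity ρ]
  refine (norm_sum_le _ _).trans ?_
  simp [AddChar.norm_apply]

theorem character_inv_of_comm (h : H) :
    ρ.character h⁻¹ = (starRingEnd ℂ) (ρ.character h) := by
  simp [character_eq_sum_multiplicity, AddChar.map_neg_eq_conj]

theorem exists_int_character_of_comm (h : H) (hh : h * h = 1) : ∃ z : ℤ, ρ.character h = z := by
  have hl (l : AddChar (Additive H) ℂ) : ∃ z : ℤ, l (.ofMul h) = z := by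
    have : l (.ofMul h) * l (.ofMul h) = 1 := by
      rw [← AddChar.map_add_eq_mul, ← ofMul_mul, hh]; simp
    rcases mul_self_eq_one_iff.mp this with h | h
    · exact ⟨1, by simp [h]⟩
    · exact ⟨-1, by simp [h]⟩
  choose z hz using hl
  exact ⟨∑ l, ρ.multiplicity l * z l, by simp [character_eq_sum_multiplicity, hz]⟩

theorem card_mul_sum_multiplicity_sq [Fintype H] :
    (Nat.card H : ℝ) * ∑ l, (ρ.multiplicity l : ℝ) ^ 2 = ∑ h, ‖ρ.character h‖ ^ 2 := by
  classical
  have hs (l k : AddChar (Additive H) ℂ) :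
      ∑ h : H, l (.ofMul h) * (starRingEnd ℂ) (k (.ofMul h)) =
      if l = k then (Nat.card H : ℂ) else 0 := by
    have := AddChar.sum_eq_ite (l - k)
    simp only [sub_eq_zero] at this
    rw [Nat.card_eq_fintype_card, ← Fintype.card_additive, ← this,
      ← Equiv.sum_comp (Additive.ofMul (α := H))]
    refine Finset.sum_congr rfl fun h _ => ?_
    rw [← AddChar.map_neg_eq_conj, AddChar.sub_apply]
  apply Complex.ofReal_injective
  push_cast
  simp_rw [← Complex.mul_conj', character_eq_sum_multiplicity, map_sum, map_mul,
    Finset.sum_mul_sum]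
  rw [Finset.sum_comm]
  simp_rw [Finset.sum_comm (s := (Finset.univ : Finset H)), mul_mul_mul_comm, ← Finset.mul_sum, hs]
  simp [Finset.mul_sum]
  refine Finset.sum_congr rfl fun h _ => by ring

/-- If the restriction of a character to a commutative group has small norm, it differs from the
regular character by at most two linear characters. -/
theorem norm_character_le_two [Fintype H]
    (hρ : ∑ h, ‖ρ.character h‖ ^ 2 < Nat.card H * (2 * Module.finrank ℂ V - Nat.card H + 3 : ℝ))
    (h : H) (hh : h ≠ 1) : ‖ρ.character h‖ ≤ 2 := by
  classical
  have hn : (0 : ℝ) < Nat.card H := by simp [Nat.card_eq_fintype_card, Fintype.card_pos]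
  rw [← card_mul_sum_multiplicity_sq, mul_lt_mul_iff_right₀ hn, ← sum_multiplicity ρ] at hρ
  have hc : ∑ l : AddChar (Additive H) ℂ, (1 : ℝ) = Nat.card H := by
    simp [Nat.card_eq_fintype_card]
  have h3 : ∑ l, ((ρ.multiplicity l : ℤ) - 1) ^ 2 < 3 := by
    have : ∑ l, ((ρ.multiplicity l : ℝ) - 1) ^ 2 < 3 := by
      simp only [sub_sq, Finset.sum_add_distrib, Finset.sum_sub_distrib, one_pow, mul_one, hc,
        ← Finset.mul_sum]
      push_cast at hρ
      linarith
    exact_mod_cast this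
  have h2 : ∑ l, ((ρ.multiplicity l : ℤ) - 1) ^ 2 ≤ 2 := by omega
  have h2' : ∑ l, ((ρ.multiplicity l : ℝ) - 1) ^ 2 ≤ 2 := by exact_mod_cast h2
  refine le_trans ?_ h2'
  have h0 : ∑ l : AddChar (Additive H) ℂ, l (.ofMul h) = 0 := by
    rw [AddChar.sum_apply_eq_zero_iff_ne_zero]
    simpa using hh
  have : ρ.character h =
      ∑ l : AddChar (Additive H) ℂ, ((ρ.multiplicity l : ℂ) - 1) * l (.ofMul h) := by
    simp [sub_mul, h0, character_eq_sum_multiplicity]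
  rw [this]
  refine (norm_sum_le _ _).trans (Finset.sum_le_sum fun l _ => ?_)
  rw [norm_mul, AddChar.norm_apply, mul_one]
  have : ((ρ.multiplicity l : ℂ) - 1) = (((ρ.multiplicity l : ℤ) - 1 : ℤ) : ℂ) := by simp
  rw [this, Complex.norm_intCast]
  have := Int.le_self_sq |(ρ.multiplicity l : ℤ) - 1|
  rw [sq_abs] at this
  exact_mod_cast this

end CommGroup

section Group

variable {G V : Type*} [Group G] [Finite G] [AddCommGroup V] [Module ℂ V] [FiniteDimensional ℂ V]
  (ρ : Representation ℂ G V)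

open scoped IsMulCommutative in
theorem norm_character_le_finrank (g : G) : ‖ρ.character g‖ ≤ Module.finrank ℂ V :=
  norm_character_le_finrank_of_comm
    (ρ.comp (Subgroup.zpowers g).subtype : Representation ℂ (Subgroup.zpowers g) V)
    ⟨g, Subgroup.mem_zpowers g⟩

open scoped IsMulCommutative in
theorem character_inv (g : G) : ρ.character g⁻¹ = (starRingEnd ℂ) (ρ.character g) :=
  character_inv_of_comm
    (ρ.comp (Subgroup.zpowers g).subtype : Representation ℂ (Subgroup.zpowers g) V)
    ⟨g, Subgroup.mem_zpowers g⟩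

open scoped IsMulCommutative in
theorem exists_int_character (g : G) (hg : g * g = 1) : ∃ z : ℤ, ρ.character g = z :=
  exists_int_character_of_comm
    (ρ.comp (Subgroup.zpowers g).subtype : Representation ℂ (Subgroup.zpowers g) V)
    ⟨g, Subgroup.mem_zpowers g⟩ (Subtype.ext hg)

end Group

end Representation

/-- Conjugates of a subgroup `H` containing the centralizers of its nontrivial elements and
meeting every conjugacy class in at most two elements cover any nontrivial element at most
`2 * |H|` times. -/
theorem Subgroup.card_mul_sum_le_of_centralizer_le {G : Type*} [Group G] [Fintype G] [DecidableEq G]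
    (H : Subgroup G) [Fintype H] (φ : G → ℝ) (hφ : ∀ g, 0 ≤ φ g) (hφc : ∀ g h, φ (h * g * h⁻¹) = φ g)
    (hH : ∀ c ∈ H, c ≠ 1 → ∀ h, h * c = c * h → h ∈ H)
    (h2 : ∀ x, (Finset.univ.filter fun c : H => IsConj (c : G) x).card ≤ 2) :
    (Fintype.card G : ℝ) * ∑ c ∈ Finset.univ.erase (1 : H), φ c ≤
      2 * Fintype.card H * ∑ x ∈ Finset.univ.erase (1 : G), φ x := by
  classical
  have hfib (x : G) (c : H) (hc : c ≠ 1) :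
      (Finset.univ.filter fun h : G => h * c * h⁻¹ = x).card ≤
        if IsConj (c : G) x then Fintype.card H else 0 := by
    split_ifs with hx
    · obtain ⟨k, hk⟩ := isConj_iff.mp hx
      rw [← Finset.card_univ]
      refine Finset.card_le_card_of_injOn
        (fun h => if hh : k⁻¹ * h ∈ H then ⟨k⁻¹ * h, hh⟩ else 1) (by simp) ?_
      have key (h : G) (hh : h * c * h⁻¹ = x) : k⁻¹ * h ∈ H := by
        refine hH c c.2 (by simpa using hc) _ ?_
        rw [← hk, mul_inv_eq_iff_eq_mul] at hh
        rw [mul_assoc, hh]; group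
      intro a ha b hb hab
      simp only [Finset.coe_filter, Finset.mem_univ, true_and, Set.mem_ofPred_eq] at ha hb
      simpa [key a ha, key b hb] using hab
    · rw [Nat.le_zero, Finset.card_eq_zero, Finset.filter_eq_empty_iff]
      exact fun h _ hh => hx (isConj_iff.mpr ⟨h, hh⟩)
  calc (Fintype.card G : ℝ) * ∑ c ∈ Finset.univ.erase (1 : H), φ c
      = ∑ c ∈ Finset.univ.erase (1 : H), ∑ h : G, φ (h * c * h⁻¹) := by
        rw [Finset.mul_sum]
        refine Finset.sum_congr rfl fun c _ => ?_
        simp [hφc]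
    _ = ∑ c ∈ Finset.univ.erase (1 : H), ∑ x ∈ Finset.univ.erase (1 : G),
          ((Finset.univ.filter fun h : G => h * c * h⁻¹ = x).card : ℝ) * φ x := by
        refine Finset.sum_congr rfl fun c hc => ?_
        rw [← Finset.sum_fiberwise_of_maps_to (t := Finset.univ.erase (1 : G))
          (g := fun h : G => h * c * h⁻¹)]
        · refine Finset.sum_congr rfl fun x _ => ?_
          rw [Finset.sum_congr rfl (g := fun _ => φ x) (by simp +contextual)]
          simp
        · intro h _
          simpa using hc
    _ ≤ ∑ c ∈ Finset.univ.erase (1 : H), ∑ x ∈ Finset.univ.erase (1 : G),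
          (if IsConj (c : G) x then (Fintype.card H : ℝ) else 0) * φ x := by
        refine Finset.sum_le_sum fun c hc => Finset.sum_le_sum fun x _ =>
          mul_le_mul_of_nonneg_right ?_ (hφ x)
        exact_mod_cast hfib x c (by simpa using hc)
    _ ≤ ∑ x ∈ Finset.univ.erase (1 : G), 2 * Fintype.card H * φ x := by
        rw [Finset.sum_comm]
        refine Finset.sum_le_sum fun x _ => ?_
        rw [← Finset.sum_mul]
        refine mul_le_mul_of_nonneg_right ?_ (hφ x)
        rw [← Finset.sum_filter, Finset.sum_const, nsmul_eq_mul]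
        refine mul_le_mul_of_nonneg_right ?_ (by positivity)
        refine le_trans ?_ (Nat.cast_le.mpr (h2 x))
        exact Nat.cast_le.mpr (Finset.card_le_card (Finset.filter_subset_filter _ (by simp)))
    _ = _ := by rw [Finset.mul_sum]

namespace Matrix.SpecialLinearGroup

variable {F : Type*} [Field F]

theorem mul_apply_fin_two (a b : SpecialLinearGroup (Fin 2) F) (i j : Fin 2) :
    (a * b) i j = a i 0 * b 0 j + a i 1 * b 1 j := by
  rw [coe_mul, Matrix.mul_apply, Fin.sum_univ_two]

theorem inv_apply_fin_two (a : SpecialLinearGroup (Fin 2) F) :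
    a⁻¹ 0 0 = a 1 1 ∧ a⁻¹ 0 1 = -a 0 1 ∧ a⁻¹ 1 0 = -a 1 0 ∧ a⁻¹ 1 1 = a 0 0 := by
  simp [coe_inv, Matrix.adjugate_fin_two]

theorem exists_coe_eq {a b c d : F} (h : a * d - b * c = 1) :
    ∃ k : SpecialLinearGroup (Fin 2) F, k 0 0 = a ∧ k 0 1 = b ∧ k 1 0 = c ∧ k 1 1 = d :=
  ⟨⟨!![a, b; c, d], by rw [Matrix.det_fin_two_of, h]⟩, rfl, rfl, rfl, rfl⟩

theorem ext_fin_two {a b : SpecialLinearGroup (Fin 2) F} (h00 : a 0 0 = b 0 0)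
    (h01 : a 0 1 = b 0 1) (h10 : a 1 0 = b 1 0) (h11 : a 1 1 = b 1 1) : a = b := by
  ext i j
  fin_cases i <;> fin_cases j <;> assumption

theorem entry_eq_of_mul_eq {a b : SpecialLinearGroup (Fin 2) F} (h : a * b = b * a) :
    a 0 1 * b 1 0 = b 0 1 * a 1 0 ∧
    a 0 0 * b 0 1 + a 0 1 * b 1 1 = b 0 0 * a 0 1 + b 0 1 * a 1 1 ∧
    a 1 0 * b 0 0 + a 1 1 * b 1 0 = b 1 0 * a 0 0 + b 1 1 * a 1 0 := by
  have h' := congrArg Subtype.val h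
  simp only [coe_mul, ← Matrix.ext_iff, Fin.forall_fin_two, Matrix.mul_apply,
    Fin.sum_univ_two] at h'
  obtain ⟨⟨h1, h2⟩, h3, h4⟩ := h'
  refine ⟨?_, h2, h3⟩
  linear_combination h1

theorem det_eq_one (g : SpecialLinearGroup (Fin 2) F) : g 0 0 * g 1 1 - g 0 1 * g 1 0 = 1 := by
  rw [← Matrix.det_fin_two, g.2]

variable [CharP F 2]

theorem exists_eq_smul_one_add_smul {c h : SpecialLinearGroup (Fin 2) F} (hc : c ≠ 1)
    (hh : h * c = c * h) :
    ∃ x y : F, (h : Matrix (Fin 2) (Fin 2) F) = x • 1 + y • (c : Matrix (Fin 2) (Fin 2) F) := by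
  obtain ⟨h1, h2, h3⟩ := entry_eq_of_mul_eq hh
  have hd := det_eq_one c
  have key (x y : F) (e1 : h 0 0 = x + y * c 0 0) (e2 : h 0 1 = y * c 0 1)
      (e3 : h 1 0 = y * c 1 0) (e4 : h 1 1 = x + y * c 1 1) :
      (h : Matrix (Fin 2) (Fin 2) F) = x • 1 + y • (c : Matrix (Fin 2) (Fin 2) F) := by
    ext i j
    fin_cases i <;> fin_cases j <;> simp [e1, e2, e3, e4]
  by_cases h10 : c 1 0 = 0
  · by_cases h01 : c 0 1 = 0
    · have hne : c 0 0 - c 1 1 ≠ 0 := by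
        intro h0
        apply hc
        rw [sub_eq_zero] at h0
        have : c 0 0 = 1 := by
          apply CharTwo.sq_injective
          simp only [one_pow]
          rw [h10, ← h0] at hd
          linear_combination hd
        ext i j
        fin_cases i <;> fin_cases j <;> simp [this, ← h0, h10, h01]
      have e2 : h 0 1 = 0 := by
        apply (mul_eq_zero.mp (?_ : (c 0 0 - c 1 1) * h 0 1 = 0)).resolve_left hne
        rw [h01] at h2; linear_combination -h2
      have e3 : h 1 0 = 0 := by
        apply (mul_eq_zero.mp (?_ : (c 0 0 - c 1 1) * h 1 0 = 0)).resolve_left hne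
        rw [h10] at h3; linear_combination h3
      refine ⟨_, _, key (h 0 0 - (h 0 0 - h 1 1) / (c 0 0 - c 1 1) * c 0 0)
        ((h 0 0 - h 1 1) / (c 0 0 - c 1 1)) (by ring) (by simp [e2, h01]) (by simp [e3, h10]) ?_⟩
      field_simp
      ring
    · have e3 : h 1 0 = 0 := by
        rw [h10] at h1
        exact (mul_eq_zero.mp (by linear_combination -h1 : c 0 1 * h 1 0 = 0)).resolve_left h01
      refine ⟨_, _, key (h 0 0 - h 0 1 / c 0 1 * c 0 0) (h 0 1 / c 0 1) (by ring)
        (by field_simp) (by simp [e3, h10]) ?_⟩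
      field_simp
      linear_combination -h2
  · refine ⟨_, _, key (h 0 0 - h 1 0 / c 1 0 * c 0 0) (h 1 0 / c 1 0) (by ring)
        ?_ (by field_simp) ?_⟩
    · field_simp
      linear_combination h1
    · field_simp
      linear_combination h3

theorem mul_comm_of_mul_comm {a b c : SpecialLinearGroup (Fin 2) F} (hc : c ≠ 1)
    (ha : a * c = c * a) (hb : b * c = c * b) : a * b = b * a := by
  obtain ⟨x, y, hx⟩ := exists_eq_smul_one_add_smul hc ha
  obtain ⟨z, w, hz⟩ := exists_eq_smul_one_add_smul hc hb
  apply Subtype.ext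
  change (a : Matrix (Fin 2) (Fin 2) F) * b = b * a
  rw [hx, hz]
  simp [mul_add, add_mul, smul_smul, mul_comm]
  abel

variable [Fintype F]

theorem exists_sq_eq (a : F) : ∃ r, r ^ 2 = a := by
  obtain ⟨r, hr⟩ := FiniteField.isSquare_of_char_two (ringChar.eq F 2 ▸ rfl) a
  exact ⟨r, by rw [sq, hr]⟩

theorem card_le : Nat.card (SpecialLinearGroup (Fin 2) F) ≤
    Fintype.card F * (Fintype.card F ^ 2 - 1) := by
  have hq : 1 < Fintype.card F := Fintype.one_lt_card
  have hinj : Function.Injective fun p : SpecialLinearGroup (Fin 2) F × Fˣ =>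
      (p.2 • (toGL p.1) : GL (Fin 2) F) := by
    rintro ⟨a, r⟩ ⟨b, s⟩ hab
    have hM := congrArg (fun g : GL (Fin 2) F => (g : Matrix (Fin 2) (Fin 2) F)) hab
    have hM' : (r : F) • (a : Matrix (Fin 2) (Fin 2) F) = (s : F) • (b : Matrix (Fin 2) (Fin 2) F) := hM
    have hd := congrArg Matrix.det hM'
    simp only [Matrix.det_smul, a.2, b.2, Fintype.card_fin, mul_one] at hd
    have hrs := CharTwo.sq_injective hd
    rw [hrs] at hM'
    have hs : (s : F) ≠ 0 := s.ne_zero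
    have := smul_right_injective _ hs hM'
    exact Prod.ext (Subtype.ext this) (Units.ext hrs)
  have := Nat.card_le_card_of_injective _ hinj
  rw [Nat.card_prod, Matrix.card_GL_field, Nat.card_units, Nat.card_eq_fintype_card (α := F)] at this
  simp only [Fin.prod_univ_two, Fin.val_zero, Fin.val_one, pow_zero, pow_one] at this
  have e : Fintype.card F ^ 2 - Fintype.card F = Fintype.card F * (Fintype.card F - 1) := by
    rw [Nat.mul_sub, sq, mul_one]
  rw [e, show (Fintype.card F ^ 2 - 1) * (Fintype.card F * (Fintype.card F - 1)) =
    Fintype.card F * (Fintype.card F ^ 2 - 1) * (Fintype.card F - 1) by ring] at this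
  exact Nat.le_of_mul_le_mul_right this (by omega)

/-- An element of `SL₂` without eigenvalues in the base field. -/
def IsNonsplit (g : SpecialLinearGroup (Fin 2) F) : Prop :=
  ∀ x : F, x ^ 2 + (g 0 0 + g 1 1) * x + 1 ≠ 0

omit [Fintype F] in
theorem isNonsplit_or_exists_conj (g : SpecialLinearGroup (Fin 2) F) :
    IsNonsplit g ∨ ∃ h : SpecialLinearGroup (Fin 2) F, (h * g * h⁻¹) 1 0 = 0 := by
  by_cases hg : IsNonsplit g
  · exact .inl hg
  right
  by_cases h10 : g 1 0 = 0
  · exact ⟨1, by simpa using h10⟩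
  simp only [IsNonsplit, not_forall, not_not] at hg
  obtain ⟨x, hx⟩ := hg
  have h2 : (2 : F) = 0 := CharTwo.two_eq_zero
  have hd := det_eq_one g
  set w := (g 1 1 + x) / g 1 0 with hw
  have hw' : w * g 1 0 = g 1 1 + x := by rw [hw]; field_simp
  obtain ⟨k, -, -, k10, k11⟩ := exists_coe_eq (F := F) (a := 0) (b := 1) (c := 1) (d := w)
    (by linear_combination -h2)
  obtain ⟨i00, -, i10, -⟩ := inv_apply_fin_two k
  refine ⟨k, mul_right_cancel₀ h10 ?_⟩
  rw [mul_apply_fin_two, mul_apply_fin_two, mul_apply_fin_two, i00, i10, k10, k11]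
  linear_combination (g 0 0 - g 1 1 + w * g 1 0 + g 1 1 + x) * hw' + hx + hd

namespace IsNonsplit

variable {g : SpecialLinearGroup (Fin 2) F} (hg : IsNonsplit g)
include hg

omit [Fintype F] in
theorem trace_ne_zero [Finite F] : g 0 0 + g 1 1 ≠ 0 := by
  have := Fintype.ofFinite F
  intro h
  have := hg 1
  rw [h] at this
  exact this (by rw [one_pow, zero_mul, add_zero, CharTwo.add_self_eq_zero])

omit [Fintype F] in
theorem apply_one_zero_ne_zero : g 1 0 ≠ 0 := by
  intro h
  have hd := det_eq_one g
  rw [h] at hd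
  apply hg (g 0 0)
  have h2 : (2 : F) = 0 := CharTwo.two_eq_zero
  linear_combination hd + (1 + g 0 0 ^ 2) * h2

omit [Fintype F] in
theorem ne_one : g ≠ 1 := by
  rintro rfl
  exact apply_one_zero_ne_zero hg (by simp)

omit [Fintype F] [CharP F 2] in
theorem det_ne_zero {x y : F} (h : x ≠ 0 ∨ y ≠ 0) :
    (x • 1 + y • (g : Matrix (Fin 2) (Fin 2) F)).det ≠ 0 := by
  have hd := det_eq_one g
  have : (x • 1 + y • (g : Matrix (Fin 2) (Fin 2) F)).det =
      x ^ 2 + (g 0 0 + g 1 1) * x * y + y ^ 2 := by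
    rw [Matrix.det_fin_two]
    simp
    linear_combination y ^ 2 * hd
  rw [this]
  by_cases hy : y = 0
  · simpa [hy] using h
  · intro h0
    apply hg (x / y)
    field_simp
    linear_combination h0

theorem card_centralizer : Nat.card (Subgroup.centralizer {g}) = Fintype.card F + 1 := by
  classical
  have h10 := hg.apply_one_zero_ne_zero
  have hcomm (h : SpecialLinearGroup (Fin 2) F) :
      h ∈ Subgroup.centralizer {g} ↔ h * g = g * h := by
    simp [Subgroup.mem_centralizer_iff, eq_comm]
  let f : Fˣ × Subgroup.centralizer {g} → {v : F × F // v ≠ 0} := fun p =>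
    ⟨((p.1 : F) * (p.2 : SpecialLinearGroup (Fin 2) F) 0 0,
      (p.1 : F) * (p.2 : SpecialLinearGroup (Fin 2) F) 1 0), by
      intro h
      have hd := det_eq_one (p.2 : SpecialLinearGroup (Fin 2) F)
      simp only [Prod.mk_eq_zero, mul_eq_zero, p.1.ne_zero, false_or] at h
      rw [h.1, h.2] at hd
      simp at hd⟩
  have hf : Function.Bijective f := by
    constructor
    · rintro ⟨r, a, ha⟩ ⟨s, b, hb⟩ hab
      obtain ⟨x, y, hx⟩ := exists_eq_smul_one_add_smul hg.ne_one ((hcomm a).mp ha)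
      obtain ⟨z, w, hz⟩ := exists_eq_smul_one_add_smul hg.ne_one ((hcomm b).mp hb)
      simp only [f, Subtype.mk.injEq, Prod.mk.injEq] at hab
      obtain ⟨h0, h1⟩ := hab
      rw [hx, hz] at h0 h1
      simp at h0 h1
      have hy : r * y = s * w := by
        apply mul_right_cancel₀ h10; linear_combination h1
      have hx' : r * x = s * z := by linear_combination h0 - g 0 0 * hy
      have hM : (r : F) • (a : Matrix (Fin 2) (Fin 2) F) = (s : F) • (b : Matrix (Fin 2) (Fin 2) F) := by
        rw [hx, hz]
        simp only [smul_add, smul_smul, hx', hy]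
      have hd := congrArg Matrix.det hM
      simp only [Matrix.det_smul, a.2, b.2, Fintype.card_fin, mul_one] at hd
      have hrs := CharTwo.sq_injective hd
      rw [hrs] at hM
      have := smul_right_injective _ s.ne_zero hM
      exact Prod.ext (Units.ext hrs) (Subtype.ext (Subtype.ext this))
    · rintro ⟨⟨u, v⟩, huv⟩
      set y := v / g 1 0 with hy
      have hy' : y * g 1 0 = v := by rw [hy]; field_simp
      set M := (u - y * g 0 0) • 1 + y • (g : Matrix (Fin 2) (Fin 2) F) with hM
      have hdet : M.det ≠ 0 := by
        apply hg.det_ne_zero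
        by_contra! h
        rw [h.2, zero_mul] at hy'
        apply huv
        rw [h.2] at h
        ext
        · simpa using h.1
        · exact hy'.symm
      obtain ⟨r, hr⟩ := exists_sq_eq M.det
      have hr0 : r ≠ 0 := by rintro rfl; exact hdet (by simpa using hr.symm)
      have hdet1 : (r⁻¹ • M).det = 1 := by
        rw [Matrix.det_smul, ← hr, Fintype.card_fin, ← mul_pow, inv_mul_cancel₀ hr0, one_pow]
      have hmem : (⟨r⁻¹ • M, hdet1⟩ : SpecialLinearGroup (Fin 2) F) ∈ Subgroup.centralizer {g} := by
        refine (hcomm _).mpr (Subtype.ext ?_)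
        change (r⁻¹ • M) * (g : Matrix (Fin 2) (Fin 2) F) =
          (g : Matrix (Fin 2) (Fin 2) F) * (r⁻¹ • M)
        rw [hM]
        simp [mul_add, add_mul]
      have hM0 : M 0 0 = u := by simp [hM]
      have hM1 : M 1 0 = v := by simp [hM, hy']
      refine ⟨(Units.mk0 r hr0, ⟨⟨r⁻¹ • M, hdet1⟩, hmem⟩), ?_⟩
      simp [f, hM0, hM1, hr0]
  have hcard := Nat.card_congr (Equiv.ofBijective f hf)
  rw [Nat.card_prod, Nat.card_units, Nat.card_eq_fintype_card (α := F)] at hcard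
  have h2 : Nat.card {v : F × F // v ≠ 0} = Fintype.card F ^ 2 - 1 := by
    rw [Nat.card_eq_fintype_card, Fintype.card_subtype_compl]
    simp [sq]
  have hq : 1 < Fintype.card F := Fintype.one_lt_card
  rw [h2, show Fintype.card F ^ 2 - 1 = (Fintype.card F - 1) * (Fintype.card F + 1) by
    rw [mul_comm]; exact Nat.sq_sub_sq _ 1] at hcard
  exact Nat.eq_of_mul_eq_mul_left (by omega) hcard

theorem card_filter_isConj_le [DecidableEq F] [Fintype (Subgroup.centralizer {g})]
    (x : SpecialLinearGroup (Fin 2) F) [DecidablePred fun c : Subgroup.centralizer {g} =>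
      IsConj (c : SpecialLinearGroup (Fin 2) F) x] :
    (Finset.univ.filter fun c : Subgroup.centralizer {g} =>
      IsConj (c : SpecialLinearGroup (Fin 2) F) x).card ≤ 2 := by
  classical
  by_contra! h
  obtain ⟨a, b, c, ha, hb, hc, hab, hac, hbc⟩ := Finset.two_lt_card_iff.mp h
  have h2 : (2 : F) = 0 := CharTwo.two_eq_zero
  have hs := hg.trace_ne_zero
  have hdg := det_eq_one g
  have hcomm (h : SpecialLinearGroup (Fin 2) F) :
      h ∈ Subgroup.centralizer {g} ↔ h * g = g * h := by
    simp [Subgroup.mem_centralizer_iff, eq_comm]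
  have key (d : Subgroup.centralizer {g}) (hd : IsConj (d : SpecialLinearGroup (Fin 2) F) x) :
      ∃ z : F, (d : SpecialLinearGroup (Fin 2) F).1 = z • 1 + ((x 0 0 + x 1 1) / (g 0 0 + g 1 1)) • (g : Matrix (Fin 2) (Fin 2) F) := by
    obtain ⟨z, w, hz⟩ := exists_eq_smul_one_add_smul hg.ne_one ((hcomm d).mp d.2)
    obtain ⟨k, rfl⟩ := isConj_iff.mp hd
    have ht : Matrix.trace ((k * d * k⁻¹ : SpecialLinearGroup (Fin 2) F) : Matrix (Fin 2) (Fin 2) F)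
        = Matrix.trace ((d : SpecialLinearGroup (Fin 2) F) : Matrix (Fin 2) (Fin 2) F) := by
      rw [coe_mul, Matrix.trace_mul_comm, ← coe_mul, ← mul_assoc, inv_mul_cancel, one_mul]
    have ht2 := ht
    rw [Matrix.trace_fin_two, hz, Matrix.trace_fin_two] at ht2
    refine ⟨z, ?_⟩
    rw [ht2]
    have : w = (((z • 1 + w • (g : Matrix (Fin 2) (Fin 2) F)) 0 0 + (z • 1 + w • (g : Matrix (Fin 2) (Fin 2) F)) 1 1) / (g 0 0 + g 1 1)) := by
      field_simp
      simp
      linear_combination -z * h2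
    rw [← this]; exact hz
  simp only [Finset.mem_filter, Finset.mem_univ, true_and] at ha hb hc
  obtain ⟨za, hza⟩ := key a ha
  obtain ⟨zb, hzb⟩ := key b hb
  obtain ⟨zc, hzc⟩ := key c hc
  set w := (x 0 0 + x 1 1) / (g 0 0 + g 1 1)
  have hdet (d : Subgroup.centralizer {g}) (z : F) (hz : (d : SpecialLinearGroup (Fin 2) F).1 = z • 1 + w • (g : Matrix (Fin 2) (Fin 2) F)) :
      z ^ 2 + (g 0 0 + g 1 1) * z * w + w ^ 2 = 1 := by
    have := (d : SpecialLinearGroup (Fin 2) F).2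
    rw [hz, Matrix.det_fin_two] at this
    simp at this
    linear_combination this - w ^ 2 * hdg
  have hdist (d e : Subgroup.centralizer {g}) (z z' : F)
      (hz : (d : SpecialLinearGroup (Fin 2) F).1 = z • 1 + w • (g : Matrix (Fin 2) (Fin 2) F))
      (hz' : (e : SpecialLinearGroup (Fin 2) F).1 = z' • 1 + w • (g : Matrix (Fin 2) (Fin 2) F))
      (hde : d ≠ e) : z - z' ≠ 0 := by
    intro h
    rw [sub_eq_zero] at h
    exact hde (Subtype.ext (Subtype.ext (by rw [hz, hz', h])))
  have h1 := hdet a za hza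
  have h3 := hdet b zb hzb
  have h4 := hdet c zc hzc
  have e1 := mul_left_cancel₀ (hdist a b za zb hza hzb hab)
    (by linear_combination h1 - h3 :
      (za - zb) * (za + zb + (g 0 0 + g 1 1) * w) = (za - zb) * 0)
  have e2 := mul_left_cancel₀ (hdist a c za zc hza hzc hac)
    (by linear_combination h1 - h4 :
      (za - zc) * (za + zc + (g 0 0 + g 1 1) * w) = (za - zc) * 0)
  exact hdist b c zb zc hzb hzc hbc (by linear_combination e1 - e2)

end IsNonsplit

section Unipotent

omit [Fintype F] [CharP F 2]

variable (F) in
/-- The upper unitriangular subgroup of `SL₂`, as a homomorphism from the additive group. -/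
def upper : Multiplicative F →* SpecialLinearGroup (Fin 2) F where
  toFun y := ⟨!![1, y.toAdd; 0, 1], by simp [Matrix.det_fin_two_of]⟩
  map_one' := ext_fin_two rfl rfl rfl rfl
  map_mul' a b := by
    apply Subtype.ext
    change _ = !![1, a.toAdd; 0, 1] * !![1, b.toAdd; 0, 1]
    simp [add_comm]

theorem upper_apply (y : Multiplicative F) :
    upper F y 0 0 = 1 ∧ upper F y 0 1 = y.toAdd ∧ upper F y 1 0 = 0 ∧ upper F y 1 1 = 1 :=
  ⟨rfl, rfl, rfl, rfl⟩

theorem exists_mul_upper_eq {g : SpecialLinearGroup (Fin 2) F} (h10 : g 1 0 = 0)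
    (hne : g 1 1 - g 0 0 ≠ 0) (y : Multiplicative F) :
    ∃ k : SpecialLinearGroup (Fin 2) F, g * upper F y = k * g * k⁻¹ := by
  set w := g 0 0 * y.toAdd / (g 1 1 - g 0 0) with hw
  have hw' : w * (g 1 1 - g 0 0) = g 0 0 * y.toAdd := by rw [hw]; field_simp
  refine ⟨upper F (.ofAdd w), ?_⟩
  rw [eq_mul_inv_iff_mul_eq, mul_assoc, ← map_mul]
  obtain ⟨a1, a2, a3, a4⟩ := upper_apply (y * .ofAdd w)
  obtain ⟨b1, b2, b3, b4⟩ := upper_apply (Multiplicative.ofAdd w)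
  rw [toAdd_mul, toAdd_ofAdd] at a2
  rw [toAdd_ofAdd] at b2
  apply ext_fin_two <;> rw [mul_apply_fin_two, mul_apply_fin_two]
  · rw [a1, a3, b1, b2, h10]; ring
  · rw [a2, a4, b1, b2]; linear_combination -hw'
  · rw [a1, a3, b3, b4, h10]; ring
  · rw [a2, a4, b3, b4, h10]; ring

/-- The big cell of unipotent elements `u * v` with `u` upper and `v` lower unitriangular. -/
theorem exists_injective_upper_mul_conj_upper :
    ∃ w : SpecialLinearGroup (Fin 2) F, Function.Injective
      fun p : Multiplicative F × Multiplicative F => upper F p.1 * (w * upper F p.2 * w⁻¹) := by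
  obtain ⟨w, w1, w2, w3, w4⟩ := exists_coe_eq (F := F) (a := 0) (b := 1) (c := -1) (d := 0) (by ring)
  obtain ⟨i1, i2, i3, i4⟩ := inv_apply_fin_two w
  have h01 (y z : Multiplicative F) : (upper F y * (w * upper F z * w⁻¹)) 0 1 = y.toAdd := by
    obtain ⟨a1, a2, a3, a4⟩ := upper_apply y
    obtain ⟨b1, b2, b3, b4⟩ := upper_apply z
    simp only [mul_apply_fin_two, i2, i4, a1, a2, b1, b2, b3, b4, w1, w2, w3, w4]
    ring
  have h10 (y z : Multiplicative F) : (upper F y * (w * upper F z * w⁻¹)) 1 0 = -z.toAdd := by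
    obtain ⟨a1, a2, a3, a4⟩ := upper_apply y
    obtain ⟨b1, b2, b3, b4⟩ := upper_apply z
    simp only [mul_apply_fin_two, i1, i3, a3, a4, b1, b2, b3, b4, w1, w2, w3, w4]
    ring
  refine ⟨w, ?_⟩
  rintro ⟨y, z⟩ ⟨y', z'⟩ h
  have e1 : y.toAdd = y'.toAdd := by
    rw [← h01 y z, ← h01 y' z']; exact congrArg (fun g : SpecialLinearGroup (Fin 2) F => g 0 1) h
  have e2 : -z.toAdd = -z'.toAdd := by
    rw [← h10 y z, ← h10 y' z']; exact congrArg (fun g : SpecialLinearGroup (Fin 2) F => g 1 0) h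
  exact Prod.ext (Multiplicative.toAdd.injective e1) (Multiplicative.toAdd.injective (neg_injective e2))

end Unipotent

theorem isConj_upper {y : Multiplicative F} (hy : y ≠ 1) : IsConj (upper F (.ofAdd 1)) (upper F y) := by
  have h2 : (2 : F) = 0 := CharTwo.two_eq_zero
  obtain ⟨r, hr⟩ := exists_sq_eq y.toAdd
  have hr0 : r ≠ 0 := by
    rintro rfl
    exact hy (Multiplicative.toAdd.injective (by simpa using hr.symm))
  obtain ⟨k, k1, k2, k3, k4⟩ := exists_coe_eq (F := F) (a := r) (b := 0) (c := 0) (d := r⁻¹)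
    (by field_simp; ring)
  refine isConj_iff.mpr ⟨k, ?_⟩
  rw [mul_inv_eq_iff_eq_mul]
  obtain ⟨a1, a2, a3, a4⟩ := upper_apply y
  obtain ⟨b1, b2, b3, b4⟩ := upper_apply (Multiplicative.ofAdd (1 : F))
  rw [toAdd_ofAdd] at b2
  apply ext_fin_two <;> rw [mul_apply_fin_two, mul_apply_fin_two]
  · rw [a1, a2, b1, b3, k1, k2, k3]; ring
  · rw [a1, a2, b2, b4, k1, k2, k4, ← hr]; field_simp; ring
  · rw [a3, a4, b1, b3, k1, k3, k4]; ring
  · rw [a3, a4, b2, b4, k2, k3, k4]; ring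

end Matrix.SpecialLinearGroup

namespace Representation

open Matrix.SpecialLinearGroup Matrix

variable {F V : Type*} [Field F] [Fintype F] [CharP F 2] [AddCommGroup V] [Module ℂ V]
  [FiniteDimensional ℂ V] {ρ : Representation ℂ (SpecialLinearGroup (Fin 2) F) V}
  [Fintype (SpecialLinearGroup (Fin 2) F)]

omit [CharP F 2] in
theorem exists_upper_apply_ne_one (hq : 3 ≤ Fintype.card F)
    (hcard : Nat.card (SpecialLinearGroup (Fin 2) F) ≤ Fintype.card F * (Fintype.card F ^ 2 - 1))
    (hd : Module.finrank ℂ V + 1 = Fintype.card F)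
    (hN : ∑ g, ‖ρ.character g‖ ^ 2 = Nat.card (SpecialLinearGroup (Fin 2) F)) :
    ∃ y, ρ (upper F y) ≠ 1 := by
  classical
  by_contra! h
  obtain ⟨w, hw⟩ := exists_injective_upper_mul_conj_upper (F := F)
  have hχ (p : Multiplicative F × Multiplicative F) :
      ‖ρ.character (upper F p.1 * (w * upper F p.2 * w⁻¹))‖ ^ 2 = (Module.finrank ℂ V : ℝ) ^ 2 := by
    have : ρ (upper F p.1 * (w * upper F p.2 * w⁻¹)) = 1 := by
      rw [map_mul, map_mul, map_mul, h, h, mul_one, one_mul, ← map_mul, mul_inv_cancel, map_one]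
    simp [character, this]
  have h1 : ∑ p : Multiplicative F × Multiplicative F, (Module.finrank ℂ V : ℝ) ^ 2 ≤
      ∑ g, ‖ρ.character g‖ ^ 2 := by
    rw [← Finset.sum_congr rfl fun p _ => hχ p, ← Finset.sum_image (f := fun g => ‖ρ.character g‖ ^ 2) hw.injOn]
    exact Finset.sum_le_sum_of_subset_of_nonneg (Finset.subset_univ _) fun _ _ _ => by positivity
  rw [hN] at h1
  simp only [Finset.sum_const, Finset.card_univ, Fintype.card_prod, Fintype.card_multiplicative,
    nsmul_eq_mul] at h1
  have h2 : Fintype.card F * Fintype.card F * Module.finrank ℂ V ^ 2 ≤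
      Nat.card (SpecialLinearGroup (Fin 2) F) := by exact_mod_cast h1
  have h3 := h2.trans hcard
  have e : Fintype.card F ^ 2 - 1 = Module.finrank ℂ V * (Module.finrank ℂ V + 2) := by
    rw [← hd]
    exact Nat.sub_eq_of_eq_add (by ring)
  rw [e, ← hd] at h3
  have h4 : 2 ≤ Module.finrank ℂ V := by omega
  nlinarith [mul_pos (show 0 < Module.finrank ℂ V by omega) (show 0 < Module.finrank ℂ V by omega),
    Nat.mul_le_mul h4 h4, Nat.mul_le_mul (Nat.mul_le_mul h4 h4) h4]

theorem sum_upper_eq_zero (hq : 3 ≤ Fintype.card F)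
    (hd : Module.finrank ℂ V + 1 = Fintype.card F)
    (hN : ∑ g, ‖ρ.character g‖ ^ 2 = Nat.card (SpecialLinearGroup (Fin 2) F)) :
    ∑ y, ρ (upper F y) = 0 ∧ ρ.character (upper F (.ofAdd 1)) = -1 := by
  classical
  let σ : Representation ℂ (Multiplicative F) V := ρ.comp (upper F)
  have hn : (Nat.card (Multiplicative F) : ℂ) ≠ 0 := by simp [Nat.card_eq_fintype_card]
  have : Invertible (Nat.card (Multiplicative F) : ℂ) := invertibleOfNonzero hn
  have : Invertible (Fintype.card (Multiplicative F) : ℂ) := by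
    rwa [Fintype.card_eq_nat_card]
  have hnF : Nat.card (Multiplicative F) = Fintype.card F := by simp [Nat.card_eq_fintype_card]
  have hinv := card_inv_mul_sum_char_eq_finrank σ
  have hy (y : Multiplicative F) (hy : y ≠ 1) :
      σ.character y = ρ.character (upper F (.ofAdd 1)) := by
    obtain ⟨k, hk⟩ := isConj_iff.mp (isConj_upper hy)
    change ρ.character (upper F y) = _
    rw [← hk, char_conj]
  obtain ⟨z, hz⟩ := exists_int_character ρ (upper F (.ofAdd 1)) (by
    rw [← map_mul, ← ofAdd_add, CharTwo.add_self_eq_zero, ofAdd_zero, map_one])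
  have hsum : (Module.finrank ℂ V : ℤ) * (1 + z) = Fintype.card F * Module.finrank ℂ σ.invariants := by
    rw [inv_mul_eq_iff_eq_mul₀ hn, ← Finset.add_sum_erase _ _ (Finset.mem_univ 1),
      Finset.sum_congr rfl (fun y hh => hy y (Finset.ne_of_mem_erase hh)), char_one, hz, hnF] at hinv
    rw [Finset.sum_const, Finset.card_erase_of_mem (Finset.mem_univ _), Finset.card_univ,
      Fintype.card_multiplicative, ← hd, nsmul_eq_mul] at hinv
    simp only [Nat.add_sub_cancel] at hinv
    rw [← hd]
    have : ((Module.finrank ℂ V : ℤ) : ℂ) * (1 + z) =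
        ((Module.finrank ℂ V + 1 : ℕ) : ℤ) * (Module.finrank ℂ σ.invariants : ℤ) := by
      push_cast at hinv ⊢
      linear_combination hinv
    exact_mod_cast this
  have hdvd : Module.finrank ℂ V ∣ Module.finrank ℂ σ.invariants := by
    have h1 : (Module.finrank ℂ V : ℤ) ∣ Fintype.card F * Module.finrank ℂ σ.invariants :=
      ⟨_, hsum.symm⟩
    have h2 : Module.finrank ℂ V ∣ Fintype.card F * Module.finrank ℂ σ.invariants := by
      exact_mod_cast h1
    refine Nat.Coprime.dvd_of_dvd_mul_left ?_ h2
    rw [← hd]; simp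
  have hle := Submodule.finrank_le σ.invariants
  have hzero : Module.finrank ℂ σ.invariants = 0 := by
    by_contra h0
    have htop := Submodule.eq_top_of_finrank_eq
      (le_antisymm hle (Nat.le_of_dvd (Nat.pos_of_ne_zero h0) hdvd))
    obtain ⟨y, hy⟩ := exists_upper_apply_ne_one hq card_le hd hN
    apply hy
    ext v
    exact (htop ▸ Submodule.mem_top : v ∈ σ.invariants) y
  constructor
  · have hbot := Submodule.finrank_eq_zero.mp hzero
    ext v
    have h1 := averageMap_invariant σ v
    rw [hbot, Submodule.mem_bot, averageMap, GroupAlgebra.average, map_smul, LinearMap.smul_apply,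
      smul_eq_zero_iff_right (by simp), map_sum] at h1
    simpa [σ] using h1
  · have : (Module.finrank ℂ V : ℤ) ≠ 0 := by
      have : Module.finrank ℂ V ≠ 0 := by omega
      exact_mod_cast this
    rw [hzero, Nat.cast_zero, mul_zero, mul_eq_zero] at hsum
    rw [hz, eq_neg_of_add_eq_zero_right (hsum.resolve_left this)]
    simp

theorem norm_character_le_two_of_apply_one_zero_eq_zero (hq : 3 ≤ Fintype.card F)
    (hd : Module.finrank ℂ V + 1 = Fintype.card F)
    (hN : ∑ g, ‖ρ.character g‖ ^ 2 = Nat.card (SpecialLinearGroup (Fin 2) F))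
    {g : SpecialLinearGroup (Fin 2) F} (hg : g ≠ 1) (h10 : g 1 0 = 0) : ‖ρ.character g‖ ≤ 2 := by
  obtain ⟨hs, hu⟩ := sum_upper_eq_zero hq hd hN
  have hdet := det_eq_one g
  rw [h10, mul_zero, sub_zero] at hdet
  by_cases h1 : g 1 1 - g 0 0 = 0
  · have h11 : g 0 0 = 1 := by
      apply CharTwo.sq_injective
      simp only [one_pow]
      linear_combination hdet - g 0 0 * h1
    rw [sub_eq_zero, h11] at h1
    have : g = upper F (.ofAdd (g 0 1)) := ext_fin_two h11 rfl h10 h1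
    rw [this] at hg ⊢
    obtain ⟨k, hk⟩ := isConj_iff.mp (isConj_upper (y := .ofAdd (g 0 1)) (by
      intro h; rw [h] at hg; exact hg (map_one _)))
    rw [← hk, char_conj, hu]
    norm_num
  · have hsum : ∑ y, ρ.character (g * upper F y) = 0 := by
      simp only [character, map_mul, ← map_sum, ← Finset.mul_sum, hs, mul_zero, map_zero]
    have hc (y : Multiplicative F) : ρ.character (g * upper F y) = ρ.character g := by
      obtain ⟨k, hk⟩ := exists_mul_upper_eq h10 h1 y
      rw [hk, char_conj]
    simp only [hc, Finset.sum_const, Finset.card_univ, nsmul_eq_mul, mul_eq_zero,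
      Nat.cast_eq_zero, Fintype.card_ne_zero, false_or] at hsum
    simp [hsum]

open scoped IsMulCommutative in
theorem norm_character_le_two_of_isNonsplit (hq : 3 ≤ Fintype.card F)
    (hd : Module.finrank ℂ V + 1 = Fintype.card F)
    (hN : ∑ g, ‖ρ.character g‖ ^ 2 = Nat.card (SpecialLinearGroup (Fin 2) F))
    {g : SpecialLinearGroup (Fin 2) F} (hg : IsNonsplit g) : ‖ρ.character g‖ ≤ 2 := by
  classical
  have hcomm (h : SpecialLinearGroup (Fin 2) F) :
      h ∈ Subgroup.centralizer {g} ↔ h * g = g * h := by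
    simp [Subgroup.mem_centralizer_iff, eq_comm]
  have : IsMulCommutative (Subgroup.centralizer {g}) :=
    IsMulCommutative.of_setLike_mul_comm fun a ha b hb =>
      mul_comm_of_mul_comm hg.ne_one ((hcomm a).mp ha) ((hcomm b).mp hb)
  have hn := hg.card_centralizer
  have hn' := hn
  rw [Nat.card_eq_fintype_card] at hn'
  have hS := Subgroup.card_mul_sum_le_of_centralizer_le (Subgroup.centralizer {g})
    (fun x => ‖ρ.character x‖ ^ 2) (fun _ => by positivity) (fun x h => by rw [char_conj])
    (fun c hc hc1 h hh => (hcomm h).mpr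
      (mul_comm_of_mul_comm hc1 hh ((hcomm c).mp hc).symm))
    (fun x => hg.card_filter_isConj_le x)
  have hdR : (Module.finrank ℂ V : ℝ) = Fintype.card F - 1 := by rw [← hd]; simp
  have h1 : ‖ρ.character 1‖ ^ 2 = ((Fintype.card F : ℝ) - 1) ^ 2 := by
    rw [char_one, Complex.norm_natCast, hdR]
  rw [Finset.sum_erase_eq_sub (Finset.mem_univ _), Finset.sum_erase_eq_sub (Finset.mem_univ _), hN,
    ← Nat.card_eq_fintype_card, hn', OneMemClass.coe_one, h1] at hS
  refine norm_character_le_two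
    (ρ.comp (Subgroup.centralizer {g}).subtype :
      Representation ℂ (Subgroup.centralizer {g}) V) ?_ ⟨g, (hcomm g).mpr rfl⟩
    (fun h => hg.ne_one (congrArg Subtype.val h))
  change ∑ h : Subgroup.centralizer {g}, ‖ρ.character h‖ ^ 2 < _
  rw [hn, hdR]
  have hG0 : (0 : ℝ) < Nat.card (SpecialLinearGroup (Fin 2) F) := by
    exact_mod_cast Nat.card_pos
  have hq' : (3 : ℝ) ≤ Fintype.card F := by exact_mod_cast hq
  push_cast at hS ⊢
  generalize (Fintype.card F : ℝ) = q at *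
  generalize (Nat.card (SpecialLinearGroup (Fin 2) F) : ℝ) = N at *
  generalize ∑ h : Subgroup.centralizer {g}, ‖ρ.character h‖ ^ 2 = S at *
  by_contra! hcon
  have hS' : 3 * q - 1 ≤ S - (q - 1) ^ 2 := by linarith
  have h2 := (mul_le_mul_of_nonneg_left hS' hG0.le).trans hS
  have h3 : 0 ≤ N * (q - 3) := mul_nonneg hG0.le (by linarith)
  have h4 : 0 < (q + 1) * (q - 1) ^ 2 := mul_pos (by linarith) (pow_pos (by linarith) 2)
  linarith

theorem norm_character_le_two_of_finrank (hq : 3 ≤ Fintype.card F)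
    (hd : Module.finrank ℂ V + 1 = Fintype.card F)
    (hN : ∑ g, ‖ρ.character g‖ ^ 2 = Nat.card (SpecialLinearGroup (Fin 2) F))
    {g : SpecialLinearGroup (Fin 2) F} (hg : g ≠ 1) : ‖ρ.character g‖ ≤ 2 := by
  rcases isNonsplit_or_exists_conj g with h | ⟨k, hk⟩
  · exact norm_character_le_two_of_isNonsplit hq hd hN h
  · rw [← char_conj ρ g k]
    exact norm_character_le_two_of_apply_one_zero_eq_zero hq hd hN (by simpa using hg) hk

end Representation

namespace FDRep

theorem sum_norm_character_sq {G : Type} [Group G] [Fintype G] (V : FDRep ℂ G)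
    [CategoryTheory.Simple V] : ∑ g, ‖V.character g‖ ^ 2 = Nat.card G := by
  have hn : (Nat.card G : ℂ) ≠ 0 := Nat.cast_ne_zero.mpr Nat.card_pos.ne'
  have : Invertible (Nat.card G : ℂ) := invertibleOfNonzero hn
  have h := char_orthonormal V V
  rw [if_pos ⟨CategoryTheory.Iso.refl V⟩, inv_mul_eq_iff_eq_mul₀ hn,
    mul_one] at h
  have h2 (g : G) : V.character g * V.character g⁻¹ = ((‖V.character g‖ ^ 2 : ℝ) : ℂ) := by
    have : V.character g⁻¹ = (starRingEnd ℂ) (V.character g) := Representation.character_inv V.ρ g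
    rw [this, Complex.mul_conj, Complex.normSq_eq_norm_sq]
  simp_rw [h2] at h
  exact_mod_cast h

end FDRep

/-- A character-sum criterion for `⟨χ ^ 4, ψ⟩ ≠ 0`: away from the identity `χ` is bounded by `2`,
so the term at the identity dominates. -/
theorem sum_pow_four_mul_conj_ne_zero {G : Type*} [Group G] [Fintype G] {χ ψ : G → ℂ} {d m : ℝ}
    (hχ1 : ‖χ 1‖ = d) (hψ1 : ‖ψ 1‖ = m) (hm : 0 < m) (hψ : ∀ g, ‖ψ g‖ ≤ m)
    (hχ : ∀ g, g ≠ 1 → ‖χ g‖ ≤ 2) (hsum : ∑ g, ‖χ g‖ ^ 2 = Nat.card G)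
    (hd : 4 * (Nat.card G - d ^ 2) < d ^ 4) :
    ∑ g, χ g ^ 4 * (starRingEnd ℂ) (ψ g) ≠ 0 := by
  classical
  intro h
  rw [← Finset.add_sum_erase _ _ (Finset.mem_univ 1)] at h hsum
  have h1 : ‖∑ g ∈ Finset.univ.erase 1, χ g ^ 4 * (starRingEnd ℂ) (ψ g)‖ ≤
      ∑ g ∈ Finset.univ.erase 1, 4 * m * ‖χ g‖ ^ 2 := by
    refine norm_sum_le_of_le _ fun g hg => ?_
    rw [norm_mul, RCLike.norm_conj, norm_pow]
    have h4 : ‖χ g‖ ^ 2 ≤ 4 := by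
      nlinarith [hχ g (Finset.ne_of_mem_erase hg), norm_nonneg (χ g)]
    calc ‖χ g‖ ^ 4 * ‖ψ g‖ = ‖χ g‖ ^ 2 * (‖χ g‖ ^ 2 * ‖ψ g‖) := by ring
      _ ≤ ‖χ g‖ ^ 2 * (4 * m) := by gcongr; exact hψ g
      _ = 4 * m * ‖χ g‖ ^ 2 := by ring
  have h2 : ‖∑ g ∈ Finset.univ.erase 1, χ g ^ 4 * (starRingEnd ℂ) (ψ g)‖ = d ^ 4 * m := by
    rw [← neg_eq_of_add_eq_zero_right h, norm_neg, norm_mul, RCLike.norm_conj, norm_pow, hχ1, hψ1]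
  rw [h2, ← Finset.mul_sum, eq_sub_of_add_eq' hsum, hχ1] at h1
  have := mul_lt_mul_of_pos_right hd hm
  linarith

/-- For `q ≥ 8` a power of `2` and `G = SL₂(F_q)`, the fourth power of any irreducible
character of degree `q - 1` contains every irreducible character of `G`. -/
theorem sl2_even_degree_q_minus_one_fourth_power_covers
    (q : ℕ) (hq8 : 8 ≤ q) (hq : ∃ n : ℕ, 1 ≤ n ∧ q = 2 ^ n)
    (F : Type) [Field F] [Fintype F] (hF : Fintype.card F = q)
    (χ ψ : Matrix.SpecialLinearGroup (Fin 2) F → ℂ)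
    (hχ : IsIrreducibleCharacter _ χ) (hχdeg : χ 1 = (q : ℂ) - 1)
    (hψ : IsIrreducibleCharacter _ ψ) :
    charInner (fun g => χ g ^ 4) ψ ≠ 0 := by
  classical
  obtain ⟨V, hV, rfl⟩ := hχ
  obtain ⟨W, hW, rfl⟩ := hψ
  have : CharP F 2 := by
    obtain ⟨n, hn, rfl⟩ := hq
    refine ringChar.of_eq (FiniteField.even_card_iff_char_two.mpr ?_)
    rw [hF]
    exact Nat.mod_eq_zero_of_dvd (dvd_pow_self 2 (by omega))
  let : Fintype (Matrix.SpecialLinearGroup (Fin 2) F) := Fintype.ofFinite _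
  have hN := FDRep.sum_norm_character_sq V
  have hM := FDRep.sum_norm_character_sq W
  have hd : Module.finrank ℂ V + 1 = q := by
    rw [FDRep.char_one] at hχdeg
    exact_mod_cast eq_sub_iff_add_eq.mp hχdeg
  have hdR : (Module.finrank ℂ V : ℝ) = q - 1 := by rw [← hd]; simp
  have hle (g) : ‖W.character g‖ ≤ Module.finrank ℂ W :=
    Representation.norm_character_le_finrank W.ρ g
  have hm : 0 < Module.finrank ℂ W := by
    by_contra h0
    have h0' (g) : ‖W.character g‖ = 0 :=
      le_antisymm ((hle g).trans_eq (by simp [Nat.eq_zero_of_not_pos h0])) (norm_nonneg _)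
    simp only [h0', ne_eq, OfNat.ofNat_ne_zero, not_false_eq_true, zero_pow, Finset.sum_const_zero]
      at hM
    exact Nat.card_pos.ne (Nat.cast_injective (R := ℝ) (by rwa [Nat.cast_zero]))
  have hG : (Nat.card (Matrix.SpecialLinearGroup (Fin 2) F) : ℝ) ≤ q * (q ^ 2 - 1) := by
    have := Nat.cast_le (α := ℝ).mpr (Matrix.SpecialLinearGroup.card_le (F := F))
    rwa [Nat.cast_mul, Nat.cast_sub (Nat.one_le_pow _ _ Fintype.card_pos), Nat.cast_pow,
      Nat.cast_one, hF] at this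
  refine mul_ne_zero (inv_ne_zero (Nat.cast_ne_zero.mpr Fintype.card_ne_zero))
    (sum_pow_four_mul_conj_ne_zero (d := q - 1) (m := Module.finrank ℂ W) ?_ ?_
      (Nat.cast_pos.mpr hm) hle
      (fun g hg => Representation.norm_character_le_two_of_finrank (ρ := V.ρ) (by omega)
        (hd.trans hF.symm) hN hg) hN ?_)
  · rw [FDRep.char_one, Complex.norm_natCast, hdR]
  · rw [FDRep.char_one, Complex.norm_natCast]
  · have hq' : (8 : ℝ) ≤ q := by exact_mod_cast hq8
    have key : 4 * ((q : ℝ) ^ 2 + 1) < (q - 1) ^ 3 := by nlinarith [sq_nonneg ((q : ℝ) - 8)]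
    have := mul_lt_mul_of_pos_left key (show (0 : ℝ) < q - 1 by linarith)
    nlinarith
end

section
/- Let q ≥ 8 be a power of 2 and G = SL₂(F_q). If χ is an irreducible complex character of G of degree q − 1 and ψ is an irreducible complex character of G of degree q + 1, then ⟨χ³, ψ⟩ = q − 2. -/
open scoped BigOperators

namespace SLTwo

open Matrix Module
open scoped MatrixGroups ComplexConjugate ComplexOrder

section Matrices

variable {F : Type} [Field F]

/-- The element of `SL(2, F)` with given entries. -/
def ofEntries (a b c d : F) (h : a * d - b * c = 1) : SL(2, F) :=
  ⟨!![a, b; c, d], by rw [det_fin_two_of, h]⟩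

@[simp] lemma coe_ofEntries (a b c d : F) (h : a * d - b * c = 1) :
    (ofEntries a b c d h : Matrix (Fin 2) (Fin 2) F) = !![a, b; c, d] := rfl

lemma mul_entry (g h : SL(2, F)) (i j : Fin 2) :
    (g * h) i j = g i 0 * h 0 j + g i 1 * h 1 j := by
  simp [Matrix.mul_apply, Fin.sum_univ_two]

lemma det_eq (g : SL(2, F)) : g 0 0 * g 1 1 - g 0 1 * g 1 0 = 1 := by
  have := g.det_coe
  rwa [det_fin_two] at this

/-- The upper unitriangular matrices, as a homomorphism from the additive group of `F`. -/
def unipotent : Multiplicative F →* SL(2, F) where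
  toFun b := ofEntries 1 b.toAdd 0 1 (by simp)
  map_one' := by ext i j; fin_cases i <;> fin_cases j <;> simp
  map_mul' a b := by
    ext i j; fin_cases i <;> fin_cases j <;> simp [mul_entry, add_comm]

@[simp] lemma coe_unipotent (b : Multiplicative F) :
    (unipotent b : Matrix (Fin 2) (Fin 2) F) = !![1, b.toAdd; 0, 1] := rfl

/-- The diagonal matrices of determinant one, as a homomorphism from `Fˣ`. -/
def torus : Fˣ →* SL(2, F) where
  toFun a := ofEntries a 0 0 (a : F)⁻¹ (by simp)
  map_one' := by ext i j; fin_cases i <;> fin_cases j <;> simp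
  map_mul' a b := by
    ext i j; fin_cases i <;> fin_cases j <;> simp [mul_entry, mul_comm]

@[simp] lemma coe_torus (a : Fˣ) :
    (torus a : Matrix (Fin 2) (Fin 2) F) = !![(a : F), 0; 0, (a : F)⁻¹] := rfl

/-- The trace of an element of `SL(2, F)`. -/
def tr (g : SL(2, F)) : F := g 0 0 + g 1 1

lemma tr_torus_mul_unipotent (a : Fˣ) (b : Multiplicative F) :
    tr (torus a * unipotent b) = a + (a : F)⁻¹ := by
  simp [tr, mul_entry]

/-- A matrix of determinant one having an eigenvalue in `F` is conjugate to a triangular one. -/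
lemma exists_isConj_torus_mul_unipotent (g : SL(2, F)) (a : Fˣ) (h : tr g = a + (a : F)⁻¹) :
    ∃ b, IsConj g (torus a * unipotent b) := by
  have hd : ((g : Matrix (Fin 2) (Fin 2) F) - (a : F) • 1).det = 0 := by
    have h1 := det_eq g
    have ha : (a : F) * (a : F)⁻¹ = 1 := by simp
    simp only [tr] at h
    simp [det_fin_two]
    linear_combination h1 - a * h - ha
  obtain ⟨v, hv, hgv⟩ := Matrix.exists_mulVec_eq_zero_iff.mpr hd
  obtain ⟨P, hP0, hP1⟩ : ∃ P : SL(2, F), P 0 0 = v 0 ∧ P 1 0 = v 1 := by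
    by_cases h0 : v 0 = 0
    · have h1 : v 1 ≠ 0 := fun h1 => hv (by ext i; fin_cases i <;> simp [h0, h1])
      exact ⟨ofEntries (v 0) (-(v 1)⁻¹) (v 1) 0 (by simp [h1]), by simp, by simp⟩
    · exact ⟨ofEntries (v 0) 0 (v 1) (v 0)⁻¹ (by simp [h0]), by simp, by simp⟩
  have e0 := congrFun hgv 0
  have e1 := congrFun hgv 1
  simp [Matrix.mulVec, dotProduct, Fin.sum_univ_two, ← hP0, ← hP1] at e0 e1
  set x := (P⁻¹ * g * P) with hx
  have hPd := det_eq P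
  have hgd := det_eq g
  have x00 : x 0 0 = a := by
    simp only [hx, mul_entry]
    simp [adjugate_fin_two]
    linear_combination P 1 1 * e0 - P 0 1 * e1 + a * hPd
  have x10 : x 1 0 = 0 := by
    simp only [hx, mul_entry]
    simp [adjugate_fin_two]
    linear_combination - P 1 0 * e0 + P 0 0 * e1
  have x11 : x 1 1 = (a : F)⁻¹ := by
    have := det_eq x
    rw [x00, x10] at this
    field_simp
    linear_combination this
  refine ⟨Multiplicative.ofAdd ((a : F)⁻¹ * x 0 1), isConj_iff.mpr ⟨P⁻¹, ?_⟩⟩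
  rw [inv_inv, ← hx]
  ext i j
  fin_cases i <;> fin_cases j <;>
    simp [mul_entry, x00, x10, x11]

/-- A matrix with the same trace as a non-scalar diagonal one is conjugate to it. -/
lemma isConj_torus (g : SL(2, F)) (a : Fˣ) (ha : (a : F) ≠ (a : F)⁻¹)
    (h : tr g = a + (a : F)⁻¹) : IsConj g (torus a) := by
  obtain ⟨b, hb⟩ := exists_isConj_torus_mul_unipotent g a h
  refine hb.trans (isConj_iff.mpr
    ⟨unipotent (Multiplicative.ofAdd (a * b.toAdd / (a - (a : F)⁻¹))), ?_⟩)
  have ha' : (a : F) - (a : F)⁻¹ ≠ 0 := sub_ne_zero.mpr ha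
  rw [mul_inv_eq_iff_eq_mul]
  ext i j
  fin_cases i <;> fin_cases j <;>
    simp [mul_entry]
  generalize (a : F)⁻¹ = a' at *
  field_simp
  ring

/-- In characteristic two, all transvections of a finite field are conjugate. -/
lemma isConj_unipotent [Finite F] [CharP F 2] (g : SL(2, F)) (hg : g ≠ 1) (h : tr g = 0) :
    IsConj g (unipotent (Multiplicative.ofAdd 1)) := by
  obtain ⟨b, hb⟩ := exists_isConj_torus_mul_unipotent g 1
    (by simp [h, CharTwo.add_self_eq_zero])
  rw [map_one, one_mul] at hb
  have hb0 : b.toAdd ≠ 0 := by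
    intro h0
    obtain rfl : b = 1 := h0
    rw [map_one, isConj_one_left] at hb
    exact hg hb
  obtain ⟨c, hc⟩ := FiniteField.isSquare_of_char_two (ringChar.eq F 2) (b.toAdd)⁻¹
  have hc0 : c ≠ 0 := by
    rintro rfl
    simp at hc
    exact hb0 hc
  refine hb.trans (isConj_iff.mpr ⟨torus (Units.mk0 c hc0), ?_⟩)
  rw [mul_inv_eq_iff_eq_mul]
  have : b.toAdd = (c * c)⁻¹ := by rw [← hc, inv_inv]
  ext i j
  fin_cases i <;> fin_cases j <;>
    simp [mul_entry, this]
  field_simp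

/-- The parametrisation of `SL(2, F)` underlying the Bruhat decomposition. -/
def bruhatEquiv [DecidableEq F] : SL(2, F) ≃ (F × F × Fˣ) ⊕ (Fˣ × F) where
  toFun g := if h : g 1 0 = 0 then
      Sum.inr (⟨g 0 0, g 1 1, by simpa [h] using det_eq g,
        by simpa [h, mul_comm] using det_eq g⟩, g 0 1)
    else Sum.inl (g 0 0, g 1 1, Units.mk0 (g 1 0) h)
  invFun := Sum.elim
    (fun p => ofEntries p.1 ((p.1 * p.2.1 - 1) * (p.2.2 : F)⁻¹) p.2.2 p.2.1 (by simp))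
    (fun p => ofEntries p.1 p.2 0 (p.1 : F)⁻¹ (by simp))
  left_inv g := by
    have := det_eq g
    by_cases h : g 1 0 = 0
    · ext i j
      fin_cases i <;> fin_cases j <;> simp [h]
      rw [h] at this
      exact inv_eq_of_mul_eq_one_right (by linear_combination this)
    · ext i j
      fin_cases i <;> fin_cases j <;> simp [h]
      field_simp
      linear_combination this
  right_inv p := by
    rcases p with ⟨x, w, z⟩ | ⟨x, y⟩
    · simp
    · simp

lemma card_units_real [Fintype F] [Fintype Fˣ] :
    (Fintype.card Fˣ : ℝ) = Fintype.card F - 1 := by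
  rw [Fintype.card_eq_nat_card, Fintype.card_eq_nat_card, Nat.card_units,
    Nat.cast_sub Nat.card_pos, Nat.cast_one]

/-- The sum over `SL(2, F)` of a function of the trace. -/
lemma sum_comp_tr [Fintype F] [Fintype Fˣ] [Fintype SL(2, F)] (h : F → ℝ) :
    ∑ g : SL(2, F), h (tr g) =
      Fintype.card F * (Fintype.card F - 1) * ∑ t, h t +
        Fintype.card F * ∑ a : Fˣ, h (a + (a : F)⁻¹) := by
  classical
  rw [← bruhatEquiv.symm.sum_comp, Fintype.sum_sum_type]
  congr 1
  · simp only [Fintype.sum_prod_type, bruhatEquiv, tr]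
    simp
    simp_rw [← Finset.mul_sum]
    have : ∀ x : F, ∑ y, h (x + y) = ∑ y, h y := fun x => Equiv.sum_comp (Equiv.addLeft x) h
    simp [this, card_units_real]
    ring
  · simp only [Fintype.sum_prod_type, bruhatEquiv, tr]
    simp [Finset.mul_sum]

lemma card_eq [Fintype F] [Fintype SL(2, F)] :
    (Fintype.card SL(2, F) : ℝ) =
      Fintype.card F * (Fintype.card F - 1) * (Fintype.card F + 1) := by
  classical
  have := sum_comp_tr (F := F) (fun _ => 1)
  simp [card_units_real] at this
  rw [this]; ring

end Matrices

section General

variable {G V : Type*} [Group G] [AddCommGroup V] [Module ℂ V] (ρ : Representation ℂ G V)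

lemma character_eq_of_isConj {g h : G} (hgh : IsConj g h) : ρ.character g = ρ.character h := by
  obtain ⟨c, rfl⟩ := isConj_iff.mp hgh
  exact (ρ.char_conj g c).symm

variable [FiniteDimensional ℂ V]

/-- Characters of finite groups take conjugate values at inverse elements. -/
lemma character_inv [Finite G] (g : G) : ρ.character g⁻¹ = conj (ρ.character g) := by
  classical
  have := Fintype.ofFinite G
  let b := finBasis ℂ V
  let M : G →* Matrix _ _ ℂ :=
    MonoidHom.comp (LinearMap.toMatrixAlgEquiv b).toRingEquiv.toMonoidHom ρ
  have htr : ∀ x, ρ.character x = (M x).trace := fun x =>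
    LinearMap.trace_eq_matrix_trace ℂ b (ρ x)
  let H : Matrix _ _ ℂ := ∑ x : G, (M x)ᴴ * M x
  have hM1 : M 1 = 1 := map_one M
  have hpos : H.PosDef := by
    have h1 : H = 1 + ∑ x ∈ Finset.univ.erase (1 : G), (M x)ᴴ * M x := by
      rw [show H = ∑ x, (M x)ᴴ * M x from rfl,
        ← Finset.add_sum_erase _ _ (Finset.mem_univ (1 : G)), hM1]
      simp
    rw [h1]
    exact Matrix.PosDef.one.add_posSemidef
      (Matrix.posSemidef_sum _ fun x _ => Matrix.posSemidef_conjTranspose_mul_self _)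
  have hinv : (M g)ᴴ * H * M g = H := by
    rw [Finset.mul_sum, Finset.sum_mul]
    refine (Finset.sum_congr rfl fun x _ => ?_).trans
      (Equiv.sum_comp (Equiv.mulRight g) fun x => (M x)ᴴ * M x)
    simp [map_mul, Matrix.conjTranspose_mul, Matrix.mul_assoc]
  have hdet : IsUnit H.det := (Matrix.isUnit_iff_isUnit_det H).mp hpos.isUnit
  have hg : M g * M g⁻¹ = 1 := by rw [← map_mul, mul_inv_cancel, hM1]
  have key : (M g)ᴴ = H * M g⁻¹ * H⁻¹ := by
    calc (M g)ᴴ = (M g)ᴴ * H * (M g * M g⁻¹) * H⁻¹ := by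
          rw [hg, Matrix.mul_one, Matrix.mul_nonsing_inv_cancel_right _ _ hdet]
      _ = H * M g⁻¹ * H⁻¹ := by rw [← Matrix.mul_assoc, hinv]
  rw [htr, htr, starRingEnd_apply, ← Matrix.trace_conjTranspose, key, Matrix.trace_mul_comm,
    ← Matrix.mul_assoc, Matrix.nonsing_inv_mul _ hdet, Matrix.one_mul]

lemma character_mul_character_inv [Finite G] (g : G) :
    ρ.character g * ρ.character g⁻¹ = (Complex.normSq (ρ.character g) : ℂ) := by
  rw [character_inv, Complex.mul_conj]

/-- The value of a character at an involution is an integer. -/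
lemma exists_int_character_eq (g : G) (hg : g * g = 1) : ∃ n : ℤ, ρ.character g = n := by
  have hsq : ∀ v, ρ g (ρ g v) = v := fun v => by
    rw [← Module.End.mul_apply, ← map_mul, hg, map_one, Module.End.one_apply]
  have hp : LinearMap.IsProj (LinearMap.ker (ρ g - 1)) ((2 : ℂ)⁻¹ • (1 + ρ g)) := by
    refine ⟨fun v => ?_, fun v hv => ?_⟩
    · simp [hsq, add_comm]
    · have : ρ g v = v := by simpa [sub_eq_zero] using hv
      rw [LinearMap.smul_apply, LinearMap.add_apply, Module.End.one_apply, this, ← two_smul ℂ v,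
        inv_smul_smul₀ two_ne_zero]
  have := hp.trace
  simp only [map_smul, map_add, LinearMap.trace_one, smul_eq_mul] at this
  refine ⟨2 * finrank ℂ (LinearMap.ker (ρ g - 1)) - finrank ℂ V, ?_⟩
  push_cast
  rw [← this, Representation.character]
  ring

/-- A two-dimensional representation of a commutative group has a non-scalar endomorphism. -/
lemma two_le_finrank_intertwiningMap {A W : Type*} [CommGroup A] [AddCommGroup W] [Module ℂ W]
    [FiniteDimensional ℂ W] (σ : Representation ℂ A W) (hW : finrank ℂ W = 2) :
    2 ≤ finrank ℂ (σ.IntertwiningMap σ) := by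
  by_contra! hlt
  obtain ⟨v, hv⟩ := finrank_le_one_iff.mp (Nat.lt_succ_iff.mp hlt)
  have scal : ∀ f : σ.IntertwiningMap σ, ∃ c : ℂ, f.toLinearMap = c • 1 := by
    intro f
    obtain ⟨c, hc⟩ := hv (Representation.IntertwiningMap.id σ)
    obtain ⟨d, hd⟩ := hv f
    have hc' : c • v.toLinearMap = 1 := congrArg (fun f => f.toLinearMap) hc
    have hd' : d • v.toLinearMap = f.toLinearMap := congrArg (fun f => f.toLinearMap) hd
    have : Nontrivial W := nontrivial_of_finrank_pos (R := ℂ) (by omega)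
    have hc0 : c ≠ 0 := by
      rintro rfl
      rw [zero_smul] at hc'
      exact zero_ne_one hc'
    exact ⟨d * c⁻¹, by rw [← hd', ← hc', smul_smul, mul_assoc, inv_mul_cancel₀ hc0, mul_one]⟩
  have hσ : ∀ a, ∃ c : ℂ, σ a = c • 1 := fun a =>
    scal ⟨σ a, fun g => by
      rw [← Module.End.mul_eq_comp, ← Module.End.mul_eq_comp, ← map_mul, ← map_mul, mul_comm]⟩
  have hall : ∀ f : W →ₗ[ℂ] W, ∃ c : ℂ, f = c • 1 := fun f =>
    scal ⟨f, fun g => by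
      obtain ⟨c, hc⟩ := hσ g
      ext w; simp [hc]⟩
  have hone : finrank ℂ (W →ₗ[ℂ] W) ≤ 1 :=
    finrank_le_one (1 : W →ₗ[ℂ] W) fun f => (hall f).imp fun _ h => h.symm
  rw [finrank_linearMap, hW] at hone
  omega

lemma two_mul_card_le_sum_normSq {A W : Type*} [CommGroup A] [Fintype A] [AddCommGroup W]
    [Module ℂ W] [FiniteDimensional ℂ W] (σ : Representation ℂ A W) (hW : finrank ℂ W = 2) :
    2 * (Fintype.card A : ℝ) ≤ ∑ a, Complex.normSq (σ.character a) := by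
  have hA : (Nat.card A : ℂ) ≠ 0 := Nat.cast_ne_zero.mpr Nat.card_pos.ne'
  have := invertibleOfNonzero hA
  have h := Representation.card_inv_mul_sum_char_mul_char_eq_finrank σ σ
  simp_rw [character_mul_character_inv] at h
  rw [inv_mul_eq_iff_eq_mul₀ hA] at h
  have h' : ∑ a, Complex.normSq (σ.character a) =
      Fintype.card A * finrank ℂ (σ.IntertwiningMap σ) := by
    rw [Nat.card_eq_fintype_card] at h
    exact_mod_cast h
  rw [h', mul_comm]
  gcongr
  exact_mod_cast two_le_finrank_intertwiningMap σ hW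

end General

section Characters

variable {F : Type} [Field F]

/-- The standard transvection. -/
def transvection : SL(2, F) := unipotent (Multiplicative.ofAdd 1)

variable {V : Type*} [AddCommGroup V] [Module ℂ V]
  (ρ : Representation ℂ SL(2, F) V)

/-- The vectors fixed by the group of upper unitriangular matrices. -/
noncomputable abbrev unipotentInvariants : Submodule ℂ V :=
  Representation.invariants (MonoidHom.comp ρ unipotent : Representation ℂ (Multiplicative F) V)

lemma unipotentInvariants_le_comap (a : Fˣ) :
    unipotentInvariants ρ ≤ (unipotentInvariants ρ).comap (ρ (torus a)) := by
  intro v hv b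
  have hcomm : unipotent b * torus a =
      torus a * unipotent (Multiplicative.ofAdd ((a : F)⁻¹ * (a : F)⁻¹ * b.toAdd)) := by
    ext i j
    fin_cases i <;> fin_cases j <;> simp [mul_entry]
    field_simp
  have hv' := hv (Multiplicative.ofAdd ((a : F)⁻¹ * (a : F)⁻¹ * b.toAdd))
  rw [MonoidHom.comp_apply] at hv' ⊢
  rw [← Module.End.mul_apply, ← map_mul, hcomm, map_mul, Module.End.mul_apply, hv']

/-- The action of the diagonal matrices on the vectors fixed by the unitriangular ones. -/
noncomputable def torusRepresentation : Representation ℂ Fˣ (unipotentInvariants ρ) :=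
  Representation.subrepresentation (MonoidHom.comp ρ torus : Representation ℂ Fˣ V)
    (unipotentInvariants ρ) (unipotentInvariants_le_comap ρ)

variable [CharP F 2]

lemma unit_add_inv_eq_zero_iff (a : Fˣ) : (a : F) + (a : F)⁻¹ = 0 ↔ a = 1 := by
  constructor
  · intro h
    have h1 : ((a : F) + 1) ^ 2 = 0 := by
      have h2 : (a : F) * (a : F)⁻¹ = 1 := by simp
      have h3 := CharTwo.add_self_eq_zero (a : F)
      linear_combination a * h - h2 + h3
    have h3 := pow_eq_zero_iff two_ne_zero |>.mp h1
    exact Units.ext (by rwa [Units.val_one, ← CharTwo.add_eq_zero])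
  · rintro rfl
    simp [CharTwo.add_self_eq_zero]

lemma unit_ne_inv {a : Fˣ} (ha : a ≠ 1) : (a : F) ≠ (a : F)⁻¹ := fun h =>
  ha ((unit_add_inv_eq_zero_iff a).mp (by rw [← h, CharTwo.add_self_eq_zero]))

lemma character_torus_mul_unipotent {a : Fˣ} (ha : a ≠ 1) (b : Multiplicative F) :
    ρ.character (torus a * unipotent b) = ρ.character (torus a) :=
  character_eq_of_isConj ρ (isConj_torus _ a (unit_ne_inv ha) (tr_torus_mul_unipotent a b))

variable [Fintype F]

lemma character_eq_of_tr_eq {g g' : SL(2, F)} (hg : g ≠ 1) (hg' : g' ≠ 1) (a : Fˣ)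
    (h : tr g = a + (a : F)⁻¹) (h' : tr g' = a + (a : F)⁻¹) :
    ρ.character g = ρ.character g' := by
  by_cases ha : a = 1
  · have h0 := (unit_add_inv_eq_zero_iff a).mpr ha
    rw [h0] at h h'
    exact character_eq_of_isConj ρ
      ((isConj_unipotent g hg h).trans (isConj_unipotent g' hg' h').symm)
  · exact character_eq_of_isConj ρ ((isConj_torus g a (unit_ne_inv ha) h).trans
      (isConj_torus g' a (unit_ne_inv ha) h').symm)

lemma character_eq_transvection {g : SL(2, F)} (hg : g ≠ 1) (h : tr g = 0) :
    ρ.character g = ρ.character (transvection : SL(2, F)) :=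
  character_eq_of_isConj ρ (isConj_unipotent g hg h)

variable [FiniteDimensional ℂ V]

lemma card_mul_finrank_unipotentInvariants :
    (Fintype.card F : ℂ) * finrank ℂ (unipotentInvariants ρ) =
      finrank ℂ V + (Fintype.card F - 1) * ρ.character (transvection : SL(2, F)) := by
  classical
  have hc : (Nat.card (Multiplicative F) : ℂ) ≠ 0 := Nat.cast_ne_zero.mpr Nat.card_pos.ne'
  have := invertibleOfNonzero hc
  let σ : Representation ℂ (Multiplicative F) V := MonoidHom.comp ρ unipotent
  have h := Representation.card_inv_mul_sum_char_eq_finrank σ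
  rw [inv_mul_eq_iff_eq_mul₀ hc] at h
  have hcard : Nat.card (Multiplicative F) = Fintype.card F := by
    rw [Nat.card_eq_fintype_card, Fintype.card_multiplicative]
  rw [hcard] at h
  rw [← h, ← Finset.add_sum_erase _ _ (Finset.mem_univ (1 : Multiplicative F)),
    Representation.char_one]
  congr 1
  rw [Finset.sum_congr rfl (g := fun _ => ρ.character (transvection : SL(2, F))), Finset.sum_const,
    Finset.card_erase_of_mem (Finset.mem_univ _), Finset.card_univ, Fintype.card_multiplicative,
    nsmul_eq_mul, Nat.cast_sub Fintype.card_pos, Nat.cast_one]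
  intro b hb
  refine character_eq_transvection ρ (g := unipotent b) (fun h1 => Finset.ne_of_mem_erase hb ?_) ?_
  · have := congrArg (fun g : SL(2, F) => g 0 1) h1
    simpa using this
  · simp [tr, CharTwo.add_self_eq_zero]

lemma character_torusRepresentation {a : Fˣ} (ha : a ≠ 1) :
    (torusRepresentation ρ).character a = ρ.character (torus a) := by
  classical
  have hc : (Fintype.card (Multiplicative F) : ℂ) ≠ 0 := Nat.cast_ne_zero.mpr Fintype.card_pos.ne'
  have := invertibleOfNonzero hc
  let σ : Representation ℂ (Multiplicative F) V := MonoidHom.comp ρ unipotent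
  have hmem : ∀ v, (ρ (torus a) * σ.averageMap) v ∈ unipotentInvariants ρ := fun v =>
    unipotentInvariants_le_comap ρ a (σ.averageMap_invariant v)
  have h1 : LinearMap.trace ℂ V (ρ (torus a) * σ.averageMap) = ρ.character (torus a) := by
    have : ρ (torus a) * σ.averageMap =
        (Fintype.card (Multiplicative F) : ℂ)⁻¹ • ∑ b, ρ (torus a * unipotent b) := by
      simp [GroupAlgebra.average, map_sum, Finset.mul_sum, σ]
    rw [this, map_smul, map_sum]
    have hs : ∀ b, LinearMap.trace ℂ V (ρ (torus a * unipotent b)) = ρ.character (torus a) :=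
      character_torus_mul_unipotent ρ ha
    simp only [hs, Finset.sum_const, Finset.card_univ, nsmul_eq_mul, smul_eq_mul]
    rw [inv_mul_cancel_left₀ hc]
  rw [← h1, ← LinearMap.trace_restrict_eq_of_forall_mem _ _ hmem]
  refine congrArg (LinearMap.trace ℂ _) (LinearMap.ext fun w => Subtype.ext ?_)
  exact congrArg (ρ (torus a)) (σ.averageMap_id w w.2).symm

lemma character_transvection_ne_finrank [Fintype SL(2, F)] (hq : 8 ≤ Fintype.card F)
    (hnorm : ∑ g, Complex.normSq (ρ.character g) = Fintype.card SL(2, F))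
    (hn : Fintype.card F ≤ finrank ℂ V + 1) :
    ρ.character (transvection : SL(2, F)) ≠ finrank ℂ V := by
  classical
  intro hc
  let h : F → ℝ := fun t => if t = 0 then (finrank ℂ V : ℝ) ^ 2 else 0
  have hh0 : ∀ t, 0 ≤ h t := fun t => by
    simp only [h]; split_ifs <;> positivity
  have hle : ∀ g : SL(2, F), h (tr g) ≤ Complex.normSq (ρ.character g) := by
    intro g
    simp only [h]
    split_ifs with h0
    · have : ρ.character g = finrank ℂ V := by
        by_cases hg : g = 1
        · rw [hg, Representation.char_one]
        · rw [character_eq_transvection ρ hg h0, hc]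
      rw [this, Complex.normSq_natCast, sq]
    · exact Complex.normSq_nonneg _
  have h1 := Finset.sum_le_sum fun g (_ : g ∈ Finset.univ) => hle g
  rw [sum_comp_tr, hnorm, card_eq] at h1
  have h2 : h ((1 : Fˣ) + ((1 : Fˣ) : F)⁻¹) ≤ ∑ a : Fˣ, h (a + (a : F)⁻¹) :=
    Finset.single_le_sum (f := fun a : Fˣ => h (a + (a : F)⁻¹)) (fun a _ => hh0 _)
      (Finset.mem_univ 1)
  have h3 : ∑ t, h t = (finrank ℂ V : ℝ) ^ 2 := by simp [h]
  have h4 : h ((1 : Fˣ) + ((1 : Fˣ) : F)⁻¹) = (finrank ℂ V : ℝ) ^ 2 := by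
    rw [(unit_add_inv_eq_zero_iff 1).mpr rfl]; simp [h]
  rw [h4] at h2
  rw [h3] at h1
  have hq' : (8 : ℝ) ≤ Fintype.card F := by exact_mod_cast hq
  have hn' : (Fintype.card F : ℝ) - 1 ≤ finrank ℂ V := by
    rw [sub_le_iff_le_add]; exact_mod_cast hn
  generalize (Fintype.card F : ℝ) = q at *
  generalize (finrank ℂ V : ℝ) = n at *
  have h5 : q * (q * n ^ 2) ≤ q * ((q - 1) * (q + 1)) := by nlinarith
  have h6 := le_of_mul_le_mul_left h5 (by linarith)
  nlinarith [pow_le_pow_left₀ (by linarith) hn' 2]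

/-- The constraints on the value of a character of large degree at a transvection. -/
lemma exists_character_transvection [Fintype SL(2, F)] (hq : 8 ≤ Fintype.card F)
    (hnorm : ∑ g, Complex.normSq (ρ.character g) = Fintype.card SL(2, F))
    (hn : Fintype.card F ≤ finrank ℂ V + 1) :
    ∃ c : ℤ, ρ.character (transvection : SL(2, F)) = c ∧ c < finrank ℂ V ∧
      (Fintype.card F : ℤ) * finrank ℂ (unipotentInvariants ρ) =
        finrank ℂ V + (Fintype.card F - 1) * c := by
  obtain ⟨c, hc⟩ := exists_int_character_eq ρ (transvection : SL(2, F)) (by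
    ext i j
    fin_cases i <;> fin_cases j <;>
      simp [transvection, mul_entry, CharTwo.add_self_eq_zero])
  have hne := character_transvection_ne_finrank ρ hq hnorm hn
  have hm := card_mul_finrank_unipotentInvariants ρ
  rw [hc] at hne hm
  have hm' : (Fintype.card F : ℤ) * finrank ℂ (unipotentInvariants ρ) =
      finrank ℂ V + (Fintype.card F - 1) * c := by exact_mod_cast hm
  refine ⟨c, hc, lt_of_le_of_ne ?_ (fun h => hne (by rw [h]; simp)), hm'⟩
  have hle : (finrank ℂ (unipotentInvariants ρ) : ℤ) ≤ finrank ℂ V := by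
    exact_mod_cast Submodule.finrank_le _
  have hq' : (8 : ℤ) ≤ Fintype.card F := by exact_mod_cast hq
  by_contra! hlt
  nlinarith

lemma discrete_series_transvection [Fintype SL(2, F)] (hq : 8 ≤ Fintype.card F)
    (hnorm : ∑ g, Complex.normSq (ρ.character g) = Fintype.card SL(2, F))
    (hn : finrank ℂ V + 1 = Fintype.card F) :
    ρ.character (transvection : SL(2, F)) = -1 ∧ finrank ℂ (unipotentInvariants ρ) = 0 := by
  obtain ⟨c, hc, hlt, hm⟩ := exists_character_transvection ρ hq hnorm hn.ge
  have hq' : (8 : ℤ) ≤ Fintype.card F := by exact_mod_cast hq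
  have hn' : (finrank ℂ V : ℤ) + 1 = Fintype.card F := by exact_mod_cast hn
  have hm0 : (0 : ℤ) ≤ finrank ℂ (unipotentInvariants ρ) := by positivity
  have key : 1 + c = Fintype.card F * (1 + c - finrank ℂ (unipotentInvariants ρ)) := by
    linear_combination hm + hn'
  have hc1 : -1 ≤ c := by nlinarith
  have h1 : 1 + c - finrank ℂ (unipotentInvariants ρ) = 0 := by nlinarith
  have hc2 : c = -1 := by rw [h1] at key; linarith
  constructor
  · rw [hc, hc2]; simp
  · have : (finrank ℂ (unipotentInvariants ρ) : ℤ) = 0 := by linarith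
    exact_mod_cast this

lemma principal_series_transvection [Fintype SL(2, F)] (hq : 8 ≤ Fintype.card F)
    (hnorm : ∑ g, Complex.normSq (ρ.character g) = Fintype.card SL(2, F))
    (hn : finrank ℂ V = Fintype.card F + 1) :
    ρ.character (transvection : SL(2, F)) = 1 ∧ finrank ℂ (unipotentInvariants ρ) = 2 := by
  obtain ⟨c, hc, hlt, hm⟩ := exists_character_transvection ρ hq hnorm (by omega)
  have hq' : (8 : ℤ) ≤ Fintype.card F := by exact_mod_cast hq
  have hn' : (finrank ℂ V : ℤ) = Fintype.card F + 1 := by exact_mod_cast hn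
  have hm0 : (0 : ℤ) ≤ finrank ℂ (unipotentInvariants ρ) := by positivity
  obtain ⟨k, hk⟩ : ∃ k : ℤ, k = 1 + c - finrank ℂ (unipotentInvariants ρ) := ⟨_, rfl⟩
  have key : c = 1 + Fintype.card F * k := by
    rw [hk]; linear_combination hm + hn'
  have hk0 : k = 0 := by
    apply le_antisymm
    · by_contra! h; nlinarith
    · by_contra! h; nlinarith
  rw [hk0, mul_zero, add_zero] at key
  constructor
  · rw [hc, key]; simp
  · have : (finrank ℂ (unipotentInvariants ρ) : ℤ) = 2 := by linarith
    exact_mod_cast this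

/-- A character of degree `q - 1` vanishes on the split semisimple elements. -/
lemma discrete_series_split [Fintype SL(2, F)] (hq : 8 ≤ Fintype.card F)
    (hnorm : ∑ g, Complex.normSq (ρ.character g) = Fintype.card SL(2, F))
    (hn : finrank ℂ V + 1 = Fintype.card F) {a : Fˣ} (ha : a ≠ 1) {g : SL(2, F)}
    (hg : tr g = a + (a : F)⁻¹) : ρ.character g = 0 := by
  have h0 := (discrete_series_transvection ρ hq hnorm hn).2
  have := finrank_zero_iff.mp h0
  rw [character_eq_of_isConj ρ (isConj_torus g a (unit_ne_inv ha) hg),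
    ← character_torusRepresentation ρ ha, Representation.character,
    Subsingleton.elim (torusRepresentation ρ a) 0, map_zero]

/-- The map `a ↦ a + a⁻¹` on `Fˣ` has fibres of size at most two, and is injective at `1`. -/
lemma sum_units_add_inv_le [Fintype Fˣ] (h : F → ℝ) (hh : ∀ t, 0 ≤ h t) :
    ∑ a : Fˣ, h (a + (a : F)⁻¹) + h 0 ≤ 2 * ∑ t, h t := by
  classical
  have hfib : ∀ t, ∑ a ∈ Finset.univ.filter fun a : Fˣ => (a : F) + (a : F)⁻¹ = t,
      h (a + (a : F)⁻¹) =
      (Finset.univ.filter fun a : Fˣ => (a : F) + (a : F)⁻¹ = t).card * h t := by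
    intro t
    rw [Finset.sum_congr rfl (g := fun _ => h t) fun a ha => by rw [(Finset.mem_filter.mp ha).2],
      Finset.sum_const, nsmul_eq_mul]
  have hcard : ∀ t, (Finset.univ.filter fun a : Fˣ => (a : F) + (a : F)⁻¹ = t).card ≤ 2 := by
    intro t
    obtain he | ⟨a, ha⟩ := (Finset.univ.filter fun a : Fˣ =>
      (a : F) + (a : F)⁻¹ = t).eq_empty_or_nonempty
    · rw [he]; simp
    · refine (Finset.card_le_card (t := {a, a⁻¹}) fun b hb => ?_).trans Finset.card_le_two
      rw [Finset.mem_filter] at ha hb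
      have hab := hb.2.trans ha.2.symm
      have h1 : ((b : F) - a) * (b - (a : F)⁻¹) = 0 := by
        have ha' : (a : F) * (a : F)⁻¹ = 1 := by simp
        have hb' : (b : F) * (b : F)⁻¹ = 1 := by simp
        linear_combination b * hab - hb' + ha'
      rcases mul_eq_zero.mp h1 with h2 | h2
      · simp [Units.ext (sub_eq_zero.mp h2)]
      · have : b = a⁻¹ := Units.ext (by rw [sub_eq_zero.mp h2]; simp)
        simp [this]
  have hcard0 : (Finset.univ.filter fun a : Fˣ => (a : F) + (a : F)⁻¹ = 0).card = 1 := by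
    simp [unit_add_inv_eq_zero_iff, Finset.filter_eq']
  rw [← Finset.sum_fiberwise (s := Finset.univ) (g := fun a : Fˣ => (a : F) + (a : F)⁻¹),
    Finset.sum_congr rfl fun t _ => hfib t, ← Finset.add_sum_erase _ _ (Finset.mem_univ (0 : F)),
    ← Finset.add_sum_erase _ h (Finset.mem_univ (0 : F)), hcard0, mul_add, Finset.mul_sum]
  have := Finset.sum_le_sum (s := Finset.univ.erase (0 : F)) fun t _ =>
    mul_le_mul_of_nonneg_right (Nat.cast_le (α := ℝ).mpr (hcard t)) (hh t)
  push_cast at this ⊢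
  linarith

/-- A character of degree `q + 1` vanishes on the elements without eigenvalues in `F`. -/
lemma principal_series_nonsplit [Fintype SL(2, F)] (hq : 8 ≤ Fintype.card F)
    (hnorm : ∑ g, Complex.normSq (ρ.character g) = Fintype.card SL(2, F))
    (hn : finrank ℂ V = Fintype.card F + 1) {g : SL(2, F)}
    (hg : ∀ a : Fˣ, tr g ≠ a + (a : F)⁻¹) : ρ.character g = 0 := by
  classical
  obtain ⟨hc, hm⟩ := principal_series_transvection ρ hq hnorm hn
  have htr : ∀ a : Fˣ, tr (torus a * transvection) = a + (a : F)⁻¹ := fun a =>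
    tr_torus_mul_unipotent a _
  have hne : ∀ a : Fˣ, torus a * transvection ≠ 1 := fun a h1 => by
    have := congrArg (fun g : SL(2, F) => g 0 1) h1
    simp [transvection, mul_entry] at this
  let h : F → ℝ := fun t => if ht : ∃ a : Fˣ, t = a + (a : F)⁻¹ then
    Complex.normSq (ρ.character (torus ht.choose * transvection)) else 0
  have hh0 : ∀ t, 0 ≤ h t := fun t => by
    simp only [h]; split_ifs
    · exact Complex.normSq_nonneg _
    · rfl
  have hsplit : ∀ x : SL(2, F), x ≠ 1 → ∀ a : Fˣ, tr x = a + (a : F)⁻¹ →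
      h (tr x) = Complex.normSq (ρ.character x) := by
    intro x hx a ha
    have ht : ∃ a : Fˣ, tr x = a + (a : F)⁻¹ := ⟨a, ha⟩
    simp only [h, dif_pos ht]
    rw [character_eq_of_tr_eq ρ hx (hne _) ht.choose ht.choose_spec (htr _)]
  have hnon : ∀ x : SL(2, F), (∀ a : Fˣ, tr x ≠ a + (a : F)⁻¹) → h (tr x) = 0 := by
    intro x hx
    simp only [h]
    exact dif_neg fun ⟨a, ha⟩ => hx a ha
  have hle : ∀ x : SL(2, F), x ≠ 1 → h (tr x) ≤ Complex.normSq (ρ.character x) := by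
    intro x hx
    by_cases hex : ∃ a : Fˣ, tr x = a + (a : F)⁻¹
    · obtain ⟨a, ha⟩ := hex
      exact (hsplit x hx a ha).le
    · push Not at hex
      rw [hnon x hex]
      exact Complex.normSq_nonneg _
  have hh1 : h 0 = 1 := by
    have h1 := htr 1
    rw [(unit_add_inv_eq_zero_iff 1).mpr rfl] at h1
    rw [← h1, hsplit _ (hne 1) 1 (htr 1), map_one, one_mul, hc, map_one]
  have hsum : ∑ a : Fˣ, h (a + (a : F)⁻¹) =
      ∑ a, Complex.normSq ((torusRepresentation ρ).character a) - 3 := by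
    rw [← Finset.add_sum_erase _ _ (Finset.mem_univ (1 : Fˣ)),
      ← Finset.add_sum_erase _ (fun a => Complex.normSq ((torusRepresentation ρ).character a))
        (Finset.mem_univ (1 : Fˣ)), (unit_add_inv_eq_zero_iff 1).mpr rfl, hh1,
      Representation.char_one, hm, Complex.normSq_natCast,
      Finset.sum_congr rfl (g := fun a => Complex.normSq ((torusRepresentation ρ).character a))]
    · push_cast; ring
    · intro a ha
      have ha1 := Finset.ne_of_mem_erase ha
      rw [← htr, hsplit _ (hne a) a (htr a), character_torusRepresentation ρ ha1, transvection,
        character_torus_mul_unipotent ρ ha1]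
  have hlow := two_mul_card_le_sum_normSq (torusRepresentation ρ) hm
  have hfib := sum_units_add_inv_le h hh0
  have htot := sum_comp_tr h
  rw [card_units_real] at hlow
  rw [hh1] at hfib
  have htr1 : tr (1 : SL(2, F)) = 0 := by simp [tr, CharTwo.add_self_eq_zero]
  have hg1 : g ≠ 1 := by
    rintro rfl
    exact hg 1 (by rw [htr1, (unit_add_inv_eq_zero_iff 1).mpr rfl])
  have hq' : (8 : ℝ) ≤ Fintype.card F := by exact_mod_cast hq
  rw [card_eq, ← Finset.add_sum_erase _ _ (Finset.mem_univ (1 : SL(2, F))),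
    Representation.char_one, Complex.normSq_natCast, hn] at hnorm
  rw [← Finset.add_sum_erase _ _ (Finset.mem_univ (1 : SL(2, F))), htr1, hh1] at htot
  push_cast at hnorm
  have hzero : ∑ x ∈ Finset.univ.erase (1 : SL(2, F)),
      (Complex.normSq (ρ.character x) - h (tr x)) ≤ 0 := by
    rw [Finset.sum_sub_distrib]
    have h1 : (Fintype.card F : ℝ) - 2 ≤ ∑ t, h t := by linarith
    have h2 : 2 * (Fintype.card F : ℝ) - 5 ≤ ∑ a : Fˣ, h (a + (a : F)⁻¹) := by linarith
    generalize (Fintype.card F : ℝ) = q at *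
    have h3 := mul_le_mul_of_nonneg_left h1 (show 0 ≤ q * (q - 1) by nlinarith)
    have h4 := mul_le_mul_of_nonneg_left h2 (show 0 ≤ q by linarith)
    linarith
  have hmem : g ∈ Finset.univ.erase (1 : SL(2, F)) := by simp [hg1]
  have h1 := (Finset.single_le_sum
    (f := fun x : SL(2, F) => Complex.normSq (ρ.character x) - h (tr x))
    (fun x hx => sub_nonneg.mpr (hle x (Finset.ne_of_mem_erase hx))) hmem).trans hzero
  rw [hnon g hg, sub_zero] at h1
  exact Complex.normSq_eq_zero.mp (le_antisymm h1 (Complex.normSq_nonneg _))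

lemma sum_character_cube_mul_conj [Fintype SL(2, F)] {W : Type*} [AddCommGroup W] [Module ℂ W]
    [FiniteDimensional ℂ W] (σ : Representation ℂ SL(2, F) W) (hq : 8 ≤ Fintype.card F)
    (hρ : ∑ g, Complex.normSq (ρ.character g) = Fintype.card SL(2, F))
    (hσ : ∑ g, Complex.normSq (σ.character g) = Fintype.card SL(2, F))
    (hV : finrank ℂ V + 1 = Fintype.card F) (hW : finrank ℂ W = Fintype.card F + 1) :
    ∑ g, ρ.character g ^ 3 * conj (σ.character g) =
      Fintype.card SL(2, F) * ((Fintype.card F : ℂ) - 2) := by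
  classical
  let k : F → ℝ := fun t => if t = 0 then -1 else 0
  let N : ℝ := (Fintype.card F - 1) ^ 3 * (Fintype.card F + 1) + 1
  have htr1 : tr (1 : SL(2, F)) = 0 := by simp [tr, CharTwo.add_self_eq_zero]
  have hpt : ∀ g : SL(2, F), ρ.character g ^ 3 * conj (σ.character g) =
      ((k (tr g) + if g = 1 then N else 0 : ℝ) : ℂ) := by
    intro g
    by_cases hg : g = 1
    · have hV' : (finrank ℂ V : ℂ) = Fintype.card F - 1 := by
        rw [eq_sub_iff_add_eq]; exact_mod_cast hV
      rw [if_pos hg, hg, htr1, Representation.char_one, Representation.char_one, hW, hV']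
      simp [k, N]
    · rw [if_neg hg, add_zero]
      by_cases h0 : tr g = 0
      · rw [character_eq_transvection ρ hg h0, character_eq_transvection σ hg h0,
          (discrete_series_transvection ρ hq hρ hV).1, (principal_series_transvection σ hq hσ hW).1]
        simp [k, h0]
        norm_num
      · have hk : k (tr g) = 0 := if_neg h0
        rw [hk]
        by_cases hex : ∃ a : Fˣ, tr g = a + (a : F)⁻¹
        · obtain ⟨a, ha⟩ := hex
          have ha1 : a ≠ 1 := fun h1 => h0 (by rw [ha, (unit_add_inv_eq_zero_iff a).mpr h1])
          rw [discrete_series_split ρ hq hρ hV ha1 ha]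
          simp
        · push Not at hex
          rw [principal_series_nonsplit σ hq hσ hW hex]
          simp
  have hk1 : ∑ t, k t = -1 := by simp [k]
  have hk2 : ∑ a : Fˣ, k (a + (a : F)⁻¹) = -1 := by
    simp [k, unit_add_inv_eq_zero_iff]
  have hreal : ∑ g : SL(2, F), (k (tr g) + if g = 1 then N else 0) =
      Fintype.card SL(2, F) * ((Fintype.card F : ℝ) - 2) := by
    rw [Finset.sum_add_distrib, sum_comp_tr, hk1, hk2, card_eq]
    simp [N]
    ring
  rw [Finset.sum_congr rfl fun g _ => hpt g, ← Complex.ofReal_sum, hreal]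
  push_cast
  rfl

end Characters

/-- First orthogonality relation, in the form of the norm of an irreducible character. -/
lemma sum_normSq_character {G : Type} [Group G] [Fintype G] (V : FDRep ℂ G)
    [CategoryTheory.Simple V] :
    ∑ g, Complex.normSq (Representation.character V.ρ g) = Fintype.card G := by
  have hG : (Nat.card G : ℂ) ≠ 0 := Nat.cast_ne_zero.mpr Nat.card_pos.ne'
  have := invertibleOfNonzero hG
  have h := FDRep.char_orthonormal V V
  have hs : ∀ g, V.character g * V.character g⁻¹ =
      (Complex.normSq (Representation.character V.ρ g) : ℂ) :=
    character_mul_character_inv V.ρ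
  rw [if_pos ⟨CategoryTheory.Iso.refl V⟩, inv_mul_eq_iff_eq_mul₀ hG, Nat.card_eq_fintype_card,
    Finset.sum_congr rfl fun g _ => hs g, mul_one] at h
  exact_mod_cast h

end SLTwo

/-- For `q ≥ 8` a power of `2` and `G = SL₂(F_q)`, if `χ` is an irreducible character of
degree `q - 1` and `ψ` an irreducible character of degree `q + 1`, then `⟨χ³, ψ⟩ = q - 2`. -/
theorem sl2_even_cube_inner_with_degree_q_plus_one
    (q : ℕ) (hq8 : 8 ≤ q) (hq : ∃ n : ℕ, 1 ≤ n ∧ q = 2 ^ n)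
    (F : Type) [Field F] [Fintype F] (hF : Fintype.card F = q)
    (χ ψ : Matrix.SpecialLinearGroup (Fin 2) F → ℂ)
    (hχ : IsIrreducibleCharacter _ χ) (hχdeg : χ 1 = (q : ℂ) - 1)
    (hψ : IsIrreducibleCharacter _ ψ) (hψdeg : ψ 1 = (q : ℂ) + 1) :
    charInner (fun g => χ g ^ 3) ψ = (q : ℂ) - 2 := by
  classical
  obtain ⟨V, hVs, rfl⟩ := hχ
  obtain ⟨W, hWs, rfl⟩ := hψ
  subst hF
  have h2 : CharP F 2 := by
    obtain ⟨n, -, hn⟩ := hq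
    have h0 := FiniteField.cast_card_eq_zero F
    rw [hn, Nat.cast_pow] at h0
    have h1 : (2 : F) = 0 := by exact_mod_cast eq_zero_of_pow_eq_zero h0
    exact CharTwo.of_one_ne_zero_of_two_eq_zero one_ne_zero h1
  let _ : Fintype (Matrix.SpecialLinearGroup (Fin 2) F) := Fintype.ofFinite _
  have hV : Module.finrank ℂ V + 1 = Fintype.card F := by
    rw [FDRep.char_one, eq_sub_iff_add_eq] at hχdeg
    exact_mod_cast hχdeg
  have hW : Module.finrank ℂ W = Fintype.card F + 1 := by
    rw [FDRep.char_one] at hψdeg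
    exact_mod_cast hψdeg
  have key := SLTwo.sum_character_cube_mul_conj V.ρ W.ρ hq8 (SLTwo.sum_normSq_character V)
    (SLTwo.sum_normSq_character W) hV hW
  have hcard : (Fintype.card (Matrix.SpecialLinearGroup (Fin 2) F) : ℂ) ≠ 0 :=
    Nat.cast_ne_zero.mpr Fintype.card_ne_zero
  unfold charInner
  exact (inv_mul_eq_iff_eq_mul₀ hcard).mpr key
end
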